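/- arXiv:1502.00361 — 3 statements merged into one kernel-verified Lean document; each statement's English description precedes it below -/
import Mathlib

section
/- Let K be the transition matrix of an irreducible birth and death chain on {0,1,...,n} with stationary distribution π, let τ_i and τ̃_i be the discrete- and continuous-time hitting times of state i, let λ_j be the smallest eigenvalue of the principal submatrix of I − K indexed by 0,...,j−1, and set δ = min_i K(i,i). Then for all 0 ≤ i < j ≤ n: (π([0,i])/(2π([0,j−1])))·(E_i τ̃_j)² ≤ Var_i(τ̃_j) ≤ (2/λ_j)·E_i τ̃_j, and (δπ([0,i])/(2π([0,j−1])))·(E_i τ_j)² ≤ Var_i(τ_j) ≤ (2/λ_j)·E_i τ_j. In particular, E_i τ_j = E_i τ̃_j ≤ 4π([0,j−1])/(π([0,i])·λ_j). -/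
open scoped BigOperators
open Filter Matrix Polynomial MeasureTheory

noncomputable section

/-- An irreducible birth and death chain on `{0,1,...,n}`, together with its
(unique) stationary distribution. -/
structure BDChain (n : ℕ) where
  K : Matrix (Fin (n + 1)) (Fin (n + 1)) ℝ
  pi : Fin (n + 1) → ℝ
  K_nonneg : ∀ i j, 0 ≤ K i j
  K_rowSum : ∀ i, ∑ j, K i j = 1
  K_tridiag : ∀ i j : Fin (n + 1), 1 < |(i : ℤ) - (j : ℤ)| → K i j = 0
  K_irred : ∀ i : ℕ, ∀ h : i < n,
    0 < K ⟨i, by omega⟩ ⟨i + 1, by omega⟩ ∧ 0 < K ⟨i + 1, by omega⟩ ⟨i, by omega⟩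
  pi_pos : ∀ i, 0 < pi i
  pi_sum : ∑ i, pi i = 1
  pi_stat : ∀ j, ∑ i, pi i * K i j = pi j

namespace BDChain

variable {n : ℕ}

/-- `π([0,M])` -/
def piLow (c : BDChain n) (M : Fin (n + 1)) : ℝ :=
  ∑ ℓ : Fin (n + 1), if ℓ ≤ M then c.pi ℓ else 0

/-- `π([M,n])` -/
def piHigh (c : BDChain n) (M : Fin (n + 1)) : ℝ :=
  ∑ ℓ : Fin (n + 1), if M ≤ ℓ then c.pi ℓ else 0

/-- `π([a,b])` -/
def piInt (c : BDChain n) (a b : Fin (n + 1)) : ℝ :=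
  ∑ ℓ : Fin (n + 1), if a ≤ ℓ ∧ ℓ ≤ b then c.pi ℓ else 0

/-- The substochastic matrix of the chain killed at state `i`. -/
def killed (c : BDChain n) (i : Fin (n + 1)) : Matrix (Fin (n + 1)) (Fin (n + 1)) ℝ :=
  Matrix.of fun x y => if x = i ∨ y = i then 0 else c.K x y

/-- `P_j(τ_i > m)`, where `τ_i` is the discrete-time hitting time of state `i`. -/
def hitSurv (c : BDChain n) (i j : Fin (n + 1)) (m : ℕ) : ℝ :=
  if j = i then 0 else ∑ y, (c.killed i ^ m) j y

/-- `P_j(τ̃_i > t)`, where `τ̃_i` is the continuous-time hitting time of state `i`. -/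
def hitSurvC (c : BDChain n) (i j : Fin (n + 1)) (t : ℝ) : ℝ :=
  ∑' m : ℕ, (Real.exp (-t) * t ^ m / m.factorial) * c.hitSurv i j m

/-- `E_j τ_i` -/
def hitMean (c : BDChain n) (i j : Fin (n + 1)) : ℝ :=
  ∑' m : ℕ, c.hitSurv i j m

/-- `Var_j τ_i` -/
def hitVar (c : BDChain n) (i j : Fin (n + 1)) : ℝ :=
  (∑' m : ℕ, (2 * (m : ℝ) + 1) * c.hitSurv i j m) - (c.hitMean i j) ^ 2

/-- `E_j τ̃_i` -/
def hitMeanC (c : BDChain n) (i j : Fin (n + 1)) : ℝ :=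
  ∫ t in Set.Ioi (0 : ℝ), c.hitSurvC i j t

/-- `Var_j τ̃_i` -/
def hitVarC (c : BDChain n) (i j : Fin (n + 1)) : ℝ :=
  (∫ t in Set.Ioi (0 : ℝ), 2 * t * c.hitSurvC i j t) - (c.hitMeanC i j) ^ 2

/-- The substochastic matrix of the chain killed at states `i` and `k`. -/
def killed2 (c : BDChain n) (i k : Fin (n + 1)) : Matrix (Fin (n + 1)) (Fin (n + 1)) ℝ :=
  Matrix.of fun x y => if x = i ∨ x = k ∨ y = i ∨ y = k then 0 else c.K x y

/-- `P_j(min{τ_i, τ_k} > m)` -/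
def hitSurv2 (c : BDChain n) (i k j : Fin (n + 1)) (m : ℕ) : ℝ :=
  if j = i ∨ j = k then 0 else ∑ y, (c.killed2 i k ^ m) j y

/-- `E_j min{τ_i, τ_k}` -/
def hitMean2 (c : BDChain n) (i k j : Fin (n + 1)) : ℝ :=
  ∑' m : ℕ, c.hitSurv2 i k j m

/-- `E_j min{τ̃_i, τ̃_k}` -/
def hitMean2C (c : BDChain n) (i k j : Fin (n + 1)) : ℝ :=
  ∫ t in Set.Ioi (0 : ℝ),
    ∑' m : ℕ, (Real.exp (-t) * t ^ m / m.factorial) * c.hitSurv2 i k j m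

/-- The continuous-time kernel `H_t(x,y) = e^{-t(I-K)}(x,y)`. -/
def Ht (c : BDChain n) (t : ℝ) (x y : Fin (n + 1)) : ℝ :=
  ∑' m : ℕ, (Real.exp (-t) * t ^ m / m.factorial) * (c.K ^ m) x y

/-- Discrete-time total variation distance from starting state `x` at time `m`. -/
def dTV (c : BDChain n) (x : Fin (n + 1)) (m : ℕ) : ℝ :=
  ⨆ A : Finset (Fin (n + 1)), (∑ y ∈ A, (c.K ^ m) x y - ∑ y ∈ A, c.pi y)

/-- Continuous-time total variation distance from starting state `x` at time `t`. -/
def dTVC (c : BDChain n) (x : Fin (n + 1)) (t : ℝ) : ℝ :=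
  ⨆ A : Finset (Fin (n + 1)), (∑ y ∈ A, c.Ht t x y - ∑ y ∈ A, c.pi y)

/-- Maximum (over starting states) discrete-time total variation distance. -/
def dTVMax (c : BDChain n) (m : ℕ) : ℝ := ⨆ x, c.dTV x m

/-- Maximum (over starting states) continuous-time total variation distance. -/
def dTVMaxC (c : BDChain n) (t : ℝ) : ℝ := ⨆ x, c.dTVC x t

/-- Discrete-time separation from starting state `x` at time `m`. -/
def sep (c : BDChain n) (x : Fin (n + 1)) (m : ℕ) : ℝ :=
  ⨆ y, (1 - (c.K ^ m) x y / c.pi y)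

/-- Continuous-time separation from starting state `x` at time `t`. -/
def sepC (c : BDChain n) (x : Fin (n + 1)) (t : ℝ) : ℝ :=
  ⨆ y, (1 - c.Ht t x y / c.pi y)

end BDChain

/-- Discrete-time `ε`-mixing time for a distance profile `d`. -/
def mixD (d : ℕ → ℝ) (ε : ℝ) : ℕ := sInf {m : ℕ | d m ≤ ε}

/-- Continuous-time `ε`-mixing time for a distance profile `d`. -/
def mixC (d : ℝ → ℝ) (ε : ℝ) : ℝ := sInf {t : ℝ | 0 ≤ t ∧ d t ≤ ε}

/-- The set of (real) eigenvalues of a square matrix. -/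
def eigSet {ι : Type*} [Fintype ι] (M : Matrix ι ι ℝ) : Set ℝ :=
  {x | ∃ v : ι → ℝ, v ≠ 0 ∧ M.mulVec v = x • v}

/-- `l` is the smallest non-zero eigenvalue of `M`. -/
def IsSmallestNonzeroEig {ι : Type*} [Fintype ι] (M : Matrix ι ι ℝ) (l : ℝ) : Prop :=
  l ∈ eigSet M ∧ l ≠ 0 ∧ ∀ x ∈ eigSet M, x ≠ 0 → l ≤ x

/-- `l` is the smallest eigenvalue of `M`. -/
def IsSmallestEig {ι : Type*} [Fintype ι] (M : Matrix ι ι ℝ) (l : ℝ) : Prop :=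
  l ∈ eigSet M ∧ ∀ x ∈ eigSet M, l ≤ x

/-- The principal submatrix of `I - K` indexed by the states `0, 1, ..., M-1`. -/
def BDChain.subIK {n : ℕ} (c : BDChain n) (M : Fin (n + 1)) :
    Matrix (Fin (M : ℕ)) (Fin (M : ℕ)) ℝ :=
  Matrix.of fun a b =>
    (1 - c.K) (Fin.castLE M.isLt.le a) (Fin.castLE M.isLt.le b)

/-- A family of chains, with `ε ↦ n ↦ T ε n` the mixing time profile, presents a cutoff
with cutoff time `t`. -/
def cutoffWith (T : ℝ → ℕ → ℝ) (t : ℕ → ℝ) : Prop :=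
  ∀ ε ∈ Set.Ioo (0 : ℝ) 1, Filter.Tendsto (fun n => T ε n / t n) Filter.atTop (nhds 1)

/-- A family of chains presents a cutoff. -/
def hasCutoff (T : ℝ → ℕ → ℝ) : Prop :=
  ∃ t : ℕ → ℝ, (∀ n, 0 < t n) ∧ cutoffWith T t

/-- A family of chains presents a `(t_n, b_n)` cutoff. -/
def cutoffWindow (T : ℝ → ℕ → ℝ) (t b : ℕ → ℝ) : Prop :=
  (∀ᶠ n in Filter.atTop, 0 < t n) ∧ (∀ᶠ n in Filter.atTop, 0 < b n) ∧
  Filter.Tendsto (fun n => b n / t n) Filter.atTop (nhds 0) ∧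
  ∀ ε ∈ Set.Ioo (0 : ℝ) 1, ∃ C : ℝ, ∀ᶠ n in Filter.atTop, |T ε n - t n| ≤ C * b n


/-! ### Solving the Poisson equation by summation -/

/-- The solution `f` of `(I - K) f = g` on `{0,...,j-1}` with `f = 0` from `j` on, for a birth and
death chain with reversible measure `p` and edge conductances `e`. -/
def bdGreen (p e : ℕ → ℝ) (j : ℕ) (g : ℕ → ℝ) (k : ℕ) : ℝ :=
  ∑ m ∈ Finset.Ico k j, (∑ l ∈ Finset.range (m + 1), p l * g l) / e m

theorem bdGreen_eq_zero (p e : ℕ → ℝ) (g : ℕ → ℝ) {j k : ℕ} (h : j ≤ k) :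
    bdGreen p e j g k = 0 := by
  simp [bdGreen, Finset.Ico_eq_empty_of_le h]

theorem bdGreen_eq_add_succ (p e : ℕ → ℝ) (g : ℕ → ℝ) {j k : ℕ} (h : k < j) :
    bdGreen p e j g k =
      (∑ l ∈ Finset.range (k + 1), p l * g l) / e k + bdGreen p e j g (k + 1) := by
  unfold bdGreen
  rw [Finset.sum_eq_sum_Ico_succ_bot h]

theorem bdGreen_nonneg {p e g : ℕ → ℝ} {j : ℕ} (hp : ∀ k < j, 0 < p k) (he : ∀ k < j, 0 < e k)
    (hg : ∀ k, 0 ≤ g k) (k : ℕ) : 0 ≤ bdGreen p e j g k := by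
  refine Finset.sum_nonneg fun m hm => ?_
  have hm' := (Finset.mem_Ico.1 hm).2
  refine div_nonneg (Finset.sum_nonneg fun l hl => ?_) (he m hm').le
  have := Finset.mem_range.1 hl
  exact mul_nonneg (hp l (by omega)).le (hg l)

theorem bdGreen_pos {p e g : ℕ → ℝ} {j : ℕ} (hp : ∀ k < j, 0 < p k) (he : ∀ k < j, 0 < e k)
    (hg : ∀ k < j, 0 < g k) {k : ℕ} (hk : k < j) : 0 < bdGreen p e j g k := by
  refine Finset.sum_pos (fun m hm => ?_) ⟨k, by simpa using hk⟩
  have hm' := (Finset.mem_Ico.1 hm).2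
  refine div_pos (Finset.sum_pos (fun l hl => ?_) ⟨0, by simp⟩) (he m hm')
  have := Finset.mem_range.1 hl
  exact mul_pos (hp l (by omega)) (hg l (by omega))

/-- Summation by parts for the mean of `bdGreen p e j 1` over an initial segment. -/
theorem sum_mul_bdGreen_one (p e : ℕ → ℝ) {j k : ℕ} (hk : k < j) :
    ∑ l ∈ Finset.range (k + 1), p l * bdGreen p e j 1 l =
      (∑ l ∈ Finset.range (k + 1), p l) * bdGreen p e j 1 k +
        ∑ m ∈ Finset.range k, (∑ l ∈ Finset.range (m + 1), p l) *
          ((∑ l ∈ Finset.range (m + 1), p l) / e m) := by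
  induction k with
  | zero => simp
  | succ k ih =>
    rw [Finset.sum_range_succ, ih (by omega), bdGreen_eq_add_succ p e 1 (show k < j by omega),
      Finset.sum_range_succ p (k + 1),
      Finset.sum_range_succ (fun m => (∑ l ∈ Finset.range (m + 1), p l) *
        ((∑ l ∈ Finset.range (m + 1), p l) / e m)) k]
    simp only [Pi.one_apply, mul_one]
    ring

/-- The variance formula: `Var_i(τ̃_j)` is the sum of the variances of the passage times from `k`
to `k + 1`. -/
theorem two_mul_bdGreen_sub_sq (p e : ℕ → ℝ) {i j : ℕ} (hij : i ≤ j) :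
    2 * bdGreen p e j (bdGreen p e j 1) i - bdGreen p e j 1 i ^ 2 =
      ∑ k ∈ Finset.Ico i j, (((∑ l ∈ Finset.range (k + 1), p l) / e k) ^ 2 +
        2 / e k * ∑ m ∈ Finset.range k, (∑ l ∈ Finset.range (m + 1), p l) *
          ((∑ l ∈ Finset.range (m + 1), p l) / e m)) := by
  induction hij using Nat.decreasingInduction with
  | self => simp [bdGreen_eq_zero]
  | of_succ k hk ih =>
    rw [Finset.sum_eq_sum_Ico_succ_bot hk, ← ih, bdGreen_eq_add_succ p e (bdGreen p e j 1) hk,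
      sum_mul_bdGreen_one p e hk, bdGreen_eq_add_succ p e 1 hk]
    simp only [Pi.one_apply, mul_one]
    ring

theorem mul_sq_sum_le_sum_add {P e a : ℕ → ℝ} {i j : ℕ} {c : ℝ} (hij : i ≤ j)
    (hP : ∀ k < j, 0 ≤ P k) (he : ∀ k < j, 0 < e k) (hmono : ∀ k < j, i ≤ k → P i ≤ P k)
    (hcP : ∀ k < j, c * P k ≤ P i) (ha : ∀ k < j, c * (P k / e k) ^ 2 ≤ a k) :
    c * (∑ k ∈ Finset.Ico i j, P k / e k) ^ 2 ≤
      ∑ k ∈ Finset.Ico i j, (a k + 2 / e k * ∑ m ∈ Finset.range k, P m * (P m / e m)) := by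
  suffices H : ∀ t, i ≤ t → t ≤ j → c * (∑ k ∈ Finset.Ico i t, P k / e k) ^ 2 ≤
      ∑ k ∈ Finset.Ico i t, (a k + 2 / e k * ∑ m ∈ Finset.range k, P m * (P m / e m)) from
    H j hij le_rfl
  intro t hit
  induction t, hit using Nat.le_induction with
  | base => simp
  | succ t hit ih =>
    intro htj
    have ht : t < j := by omega
    rw [Finset.sum_Ico_succ_top hit, Finset.sum_Ico_succ_top hit]
    have h1 := ih ht.le
    have h2 := ha t ht
    have hS0 : 0 ≤ ∑ k ∈ Finset.Ico i t, P k / e k := Finset.sum_nonneg fun k hk => by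
      have := (Finset.mem_Ico.1 hk).2
      exact div_nonneg (hP k (by omega)) (he k (by omega)).le
    have hS : P i * ∑ k ∈ Finset.Ico i t, P k / e k ≤
        ∑ m ∈ Finset.range t, P m * (P m / e m) := by
      rw [Finset.mul_sum]
      calc ∑ k ∈ Finset.Ico i t, P i * (P k / e k)
          ≤ ∑ k ∈ Finset.Ico i t, P k * (P k / e k) := by
            refine Finset.sum_le_sum fun k hk => ?_
            have := Finset.mem_Ico.1 hk
            exact mul_le_mul_of_nonneg_right (hmono k (by omega) this.1)
              (div_nonneg (hP k (by omega)) (he k (by omega)).le)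
        _ ≤ _ := by
            refine Finset.sum_le_sum_of_subset_of_nonneg (fun k hk => ?_) fun k hk _ => ?_
            · simpa using (Finset.mem_Ico.1 hk).2
            · have := Finset.mem_range.1 hk
              exact mul_nonneg (hP k (by omega)) (div_nonneg (hP k (by omega)) (he k (by omega)).le)
    have h3 : c * (P t / e t) * ∑ k ∈ Finset.Ico i t, P k / e k ≤
        1 / e t * ∑ m ∈ Finset.range t, P m * (P m / e m) := by
      have h5 := mul_le_mul_of_nonneg_right (hcP t ht) hS0
      have h6 := mul_le_mul_of_nonneg_left (h5.trans hS) (one_div_pos.2 (he t ht)).le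
      refine le_trans (le_of_eq ?_) h6
      ring
    have h4 : 2 / e t * ∑ m ∈ Finset.range t, P m * (P m / e m) =
        2 * (1 / e t * ∑ m ∈ Finset.range t, P m * (P m / e m)) := by ring
    rw [h4]
    nlinarith

/-! ### Survival series -/

theorem hasSum_of_telescope {s T : ℕ → ℝ} {C : ℝ} (hs : ∀ m, 0 ≤ s m) (hT : ∀ m, 0 ≤ T m)
    (h : ∀ m, s m = T m - T (m + 1)) (hC : ∀ m, T m ≤ C * s m) : HasSum s (T 0) := by
  have hsum : ∀ M, ∑ m ∈ Finset.range M, s m = T 0 - T M := fun M => by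
    simp_rw [h]
    exact Finset.sum_range_sub' T M
  have hsm : Summable s := summable_of_sum_range_le hs fun M => by
    rw [hsum]; linarith [hT M]
  have hT0 : Tendsto T atTop (nhds 0) :=
    squeeze_zero hT hC (by simpa using hsm.tendsto_atTop_zero.const_mul C)
  rw [hasSum_iff_tendsto_nat_of_nonneg hs]
  simp_rw [hsum]
  simpa using hT0.const_sub (T 0)

theorem hasSum_succ_mul_of_telescope {s U W : ℕ → ℝ} {C D : ℝ} (hs : ∀ m, 0 ≤ s m)
    (hU : ∀ m, 0 ≤ U m) (hW : ∀ m, 0 ≤ W m) (hD : 0 ≤ D)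
    (h : ∀ m, s m = U m - U (m + 1)) (h' : ∀ m, U m = W m - W (m + 1))
    (hC : ∀ m, U m ≤ C * s m) (hWD : ∀ m, W m ≤ D * U m) :
    HasSum (fun m : ℕ => ((m : ℝ) + 1) * s m) (W 0) := by
  have key := hasSum_of_telescope (s := fun m : ℕ => ((m : ℝ) + 1) * s m)
    (T := fun m : ℕ => (m : ℝ) * U m + W m) (C := C + D * C) (fun m => by have := hs m; positivity)
    (fun m => by have := hU m; have := hW m; positivity)
    (fun m => by
      have := h' m
      simp only [h m, this]
      push_cast
      rw [h' (m + 1)]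
      ring)
    (fun m => by
      have h1 := mul_le_mul_of_nonneg_left (hC m) (Nat.cast_nonneg (α := ℝ) m)
      have h2 := (hWD m).trans (mul_le_mul_of_nonneg_left (hC m) hD)
      have h3 := hU m
      have h4 : 0 ≤ C * s m := h3.trans (hC m)
      have h5 : 0 ≤ (m : ℝ) * (D * (C * s m)) := by positivity
      nlinarith)
  simpa using key

/-- Moments of a Poisson mixture: the `k`-th moment of `∑ e⁻ᵗ tᵐ/m! sₘ` in `t`. -/
theorem integral_pow_mul_tsum_poisson {s : ℕ → ℝ} (hs : ∀ m, 0 ≤ s m) (k : ℕ)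
    (hsum : Summable fun m : ℕ => ((m + k).factorial / m.factorial : ℝ) * s m) :
    ∫ t in Set.Ioi (0 : ℝ), t ^ k * ∑' m : ℕ, (Real.exp (-t) * t ^ m / m.factorial) * s m =
      ∑' m : ℕ, ((m + k).factorial / m.factorial : ℝ) * s m := by
  have hgamma : ∀ m : ℕ, IntegrableOn (fun t : ℝ => Real.exp (-t) * t ^ (m + k)) (Set.Ioi 0) :=
    fun m => by
      have := Real.GammaIntegral_convergent (s := (m + k : ℕ) + 1) (by positivity)
      simpa only [add_sub_cancel_right, Real.rpow_natCast] using this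
  have hval : ∀ m : ℕ, ∫ t in Set.Ioi (0 : ℝ), Real.exp (-t) * t ^ (m + k) = (m + k).factorial :=
    fun m => by
      have := Real.Gamma_eq_integral (s := (m + k : ℕ) + 1) (by positivity)
      rw [Real.Gamma_nat_eq_factorial] at this
      rw [this]
      simp only [add_sub_cancel_right, Real.rpow_natCast]
  have heq : ∀ m : ℕ, (fun t : ℝ => t ^ k * ((Real.exp (-t) * t ^ m / m.factorial) * s m)) =
      fun t => (s m / m.factorial) * (Real.exp (-t) * t ^ (m + k)) := fun m => by
    ext t; ring
  have hI : ∀ m : ℕ, ∫ t in Set.Ioi (0 : ℝ), t ^ k * ((Real.exp (-t) * t ^ m / m.factorial) * s m)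
      = ((m + k).factorial / m.factorial : ℝ) * s m := fun m => by
    rw [heq, integral_const_mul, hval]; ring
  have hn : ∀ m : ℕ,
      ∫ t in Set.Ioi (0 : ℝ), ‖t ^ k * ((Real.exp (-t) * t ^ m / m.factorial) * s m)‖
      = ((m + k).factorial / m.factorial : ℝ) * s m := fun m => by
    rw [← hI]
    refine setIntegral_congr_fun measurableSet_Ioi fun t ht => ?_
    have ht' : (0 : ℝ) < t := ht
    have := hs m
    exact Real.norm_of_nonneg (by positivity)
  have key := integral_tsum_of_summable_integral_norm
    (μ := volume.restrict (Set.Ioi (0 : ℝ)))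
    (F := fun (m : ℕ) (t : ℝ) => t ^ k * ((Real.exp (-t) * t ^ m / m.factorial) * s m))
    (fun m => by rw [heq]; exact (hgamma m).const_mul _) (by simpa only [hn] using hsum)
  simp_rw [hI] at key
  rw [key]
  simp_rw [tsum_mul_left]

/-! ### Eigenvalue bounds -/

section Eigenvalues

variable {ι : Type*} [Fintype ι] [DecidableEq ι]

/-- The Rayleigh quotient bound for a matrix that is self-adjoint with respect to the weight `p`. -/
theorem mul_sum_sq_le_of_le_eigSet {A : Matrix ι ι ℝ} {p : ι → ℝ} (hp : ∀ a, 0 < p a)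
    (hsymm : ∀ a b, p a * A a b = p b * A b a) {l : ℝ} (hl : ∀ x ∈ eigSet A, l ≤ x) (f : ι → ℝ) :
    l * ∑ a, p a * f a ^ 2 ≤ ∑ a, p a * f a * (A *ᵥ f) a := by
  have hq : ∀ a, 0 < √(p a) := fun a => Real.sqrt_pos.2 (hp a)
  have hqq : ∀ a, √(p a) * √(p a) = p a := fun a => Real.mul_self_sqrt (hp a).le
  let S : Matrix ι ι ℝ := Matrix.of fun a b => √(p a) * A a b / √(p b)
  have hS : ∀ (v : ι → ℝ) (a), (S *ᵥ v) a = √(p a) * (A *ᵥ fun b => v b / √(p b)) a := by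
    intro v a
    simp only [mulVec, dotProduct, S, Matrix.of_apply, Finset.mul_sum]
    exact Finset.sum_congr rfl fun b _ => by ring
  have hM : (S - l • (1 : Matrix ι ι ℝ)).IsHermitian := by
    refine Matrix.IsHermitian.ext fun a b => ?_
    have h1 : S b a = S a b := by
      simp only [S, Matrix.of_apply]
      rw [div_eq_div_iff (hq a).ne' (hq b).ne']
      linear_combination A b a * hqq b - A a b * hqq a - hsymm a b
    simp [h1, Matrix.one_apply, eq_comm]
  have hpsd : (S - l • (1 : Matrix ι ι ℝ)).PosSemidef := by
    rw [hM.posSemidef_iff_eigenvalues_nonneg]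
    intro i
    have hv := hM.mulVec_eigenvectorBasis i
    set v : ι → ℝ := ⇑(hM.eigenvectorBasis i) with hv_def
    have hv0 : v ≠ 0 := fun h => hM.eigenvectorBasis.toBasis.ne_zero i (by
      ext a
      simpa using congrFun h a)
    have hmem : l + hM.eigenvalues i ∈ eigSet A := by
      refine ⟨fun a => v a / √(p a), fun h => hv0 ?_, ?_⟩
      · ext a
        have := congrFun h a
        simpa [(hq a).ne'] using this
      · ext a
        have h1 := congrFun hv a
        rw [Matrix.sub_mulVec, Matrix.smul_mulVec, Matrix.one_mulVec] at h1
        simp only [Pi.sub_apply, Pi.smul_apply, smul_eq_mul, hS] at h1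
        simp only [Pi.smul_apply, smul_eq_mul]
        have := (hq a).ne'
        field_simp
        linarith
    have := hl _ hmem
    simpa using this
  have h0 := hpsd.dotProduct_mulVec_nonneg (fun a => √(p a) * f a)
  have hdiv : (fun b => √(p b) * f b / √(p b)) = f := by
    ext b
    have := (hq b).ne'
    field_simp
  rw [Matrix.sub_mulVec, Matrix.smul_mulVec, Matrix.one_mulVec] at h0
  simp only [dotProduct, Pi.sub_apply, Pi.smul_apply, smul_eq_mul, hS, hdiv, Pi.star_apply,
    star_trivial] at h0
  rw [← sub_nonneg, Finset.mul_sum, ← Finset.sum_sub_distrib]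
  refine h0.trans_eq (Finset.sum_congr rfl fun a _ => ?_)
  linear_combination (f a * (A *ᵥ f) a - l * f a ^ 2) * hqq a

/-- A nonnegative matrix `Q` for which `(1 - Q) u = 1` has a positive solution is such that `1 - Q`
has only positive eigenvalues. -/
theorem pos_of_mem_eigSet_one_sub {Q : Matrix ι ι ℝ} (hQ : ∀ a b, 0 ≤ Q a b) {u : ι → ℝ}
    (hu : ∀ a, 0 < u a) (hQu : (1 - Q) *ᵥ u = 1) {x : ℝ} (hx : x ∈ eigSet (1 - Q)) : 0 < x := by
  obtain ⟨v, hv0, hv⟩ := hx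
  obtain ⟨a₀, ha₀⟩ := Function.ne_iff.1 hv0
  obtain ⟨a, -, ha⟩ := Finset.exists_max_image Finset.univ (fun a => |v a| / u a) ⟨a₀, by simp⟩
  set r := |v a| / u a with hr
  have hr0 : 0 < r := lt_of_lt_of_le (div_pos (abs_pos.2 ha₀) (hu a₀)) (ha a₀ (by simp))
  have hva : |v a| = r * u a := by rw [hr, div_mul_cancel₀ _ (hu a).ne']
  have hvb : ∀ b, |v b| ≤ r * u b := fun b => (div_le_iff₀ (hu b)).1 (ha b (by simp))
  have h1 := congrFun hv a
  have h2 := congrFun hQu a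
  simp only [Matrix.sub_mulVec, Matrix.one_mulVec, Pi.sub_apply, Pi.smul_apply, smul_eq_mul,
    Pi.one_apply] at h1 h2
  have h3 : |(Q *ᵥ v) a| ≤ r * (Q *ᵥ u) a := by
    simp only [mulVec, dotProduct, Finset.mul_sum]
    refine (Finset.abs_sum_le_sum_abs _ _).trans (Finset.sum_le_sum fun b _ => ?_)
    rw [abs_mul, abs_of_nonneg (hQ a b)]
    nlinarith [mul_le_mul_of_nonneg_left (hvb b) (hQ a b)]
  by_contra! hx
  have h4 : (Q *ᵥ v) a = (1 - x) * v a := by linarith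
  rw [h4, abs_mul, abs_of_nonneg (by linarith : 0 ≤ 1 - x), hva] at h3
  have h5 : 0 < r * u a := mul_pos hr0 (hu a)
  nlinarith

end Eigenvalues

namespace BDChain

variable {n : ℕ} (c : BDChain n)

/-! ### The chain indexed by the natural numbers -/

/-- The stationary distribution, extended by zero to `ℕ`. -/
def natPi (k : ℕ) : ℝ := if h : k < n + 1 then c.pi ⟨k, h⟩ else 0

/-- The transition matrix, extended by zero to `ℕ × ℕ`. -/
def natK (a b : ℕ) : ℝ := if h : a < n + 1 ∧ b < n + 1 then c.K ⟨a, h.1⟩ ⟨b, h.2⟩ else 0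

/-- The conductance of the edge `{k, k + 1}`. -/
def natE (k : ℕ) : ℝ := c.natPi k * c.natK k (k + 1)

@[simp]
theorem natPi_val (x : Fin (n + 1)) : c.natPi x = c.pi x :=
  dif_pos x.isLt

@[simp]
theorem natK_val (x y : Fin (n + 1)) : c.natK x y = c.K x y :=
  dif_pos ⟨x.isLt, y.isLt⟩

theorem natPi_pos {k : ℕ} (h : k ≤ n) : 0 < c.natPi k := by
  rw [natPi, dif_pos (by omega)]
  exact c.pi_pos _

theorem natPi_nonneg (k : ℕ) : 0 ≤ c.natPi k := by
  unfold natPi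
  split_ifs
  exacts [(c.pi_pos _).le, le_rfl]

theorem natE_pos {k : ℕ} (h : k < n) : 0 < c.natE k := by
  refine mul_pos (c.natPi_pos h.le) ?_
  rw [natK, dif_pos (by omega)]
  exact (c.K_irred k h).1

theorem natK_eq_zero_of_lt_left {a : ℕ} (h : n < a) (b : ℕ) : c.natK a b = 0 := by
  rw [natK, dif_neg (by omega)]

theorem natK_eq_zero_of_lt_right (a : ℕ) {b : ℕ} (h : n < b) : c.natK a b = 0 := by
  rw [natK, dif_neg (by omega)]

theorem natK_eq_zero {a b : ℕ} (h : a + 1 < b ∨ b + 1 < a) : c.natK a b = 0 := by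
  unfold natK
  split_ifs with hab
  · refine c.K_tridiag _ _ ?_
    rw [lt_abs]
    simp only
    omega
  · rfl

theorem sum_range_eq_zero_add {g : ℕ → ℝ} (hn : ∀ b, n < b → g b = 0)
    (h : ∀ b, 1 < b → g b = 0) : ∑ b ∈ Finset.range (n + 1), g b = g 0 + g 1 := by
  rw [← Finset.sum_pair (show (0 : ℕ) ≠ 1 by simp)]
  refine Finset.sum_congr_of_eq_on_inter (fun b _ hb => h b ?_) (fun b _ hb => hn b ?_)
    fun _ _ _ => rfl
  · simp at hb; omega
  · simp at hb; omega

theorem sum_range_eq_add_add {g : ℕ → ℝ} (k : ℕ) (hn : ∀ b, n < b → g b = 0)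
    (h : ∀ b, b < k ∨ k + 2 < b → g b = 0) :
    ∑ b ∈ Finset.range (n + 1), g b = g k + g (k + 1) + g (k + 2) := by
  have h3 : ∑ b ∈ Finset.Ico k (k + 3), g b = g k + g (k + 1) + g (k + 2) := by
    simp [Finset.sum_Ico_eq_sum_range, Finset.sum_range_succ]
  rw [← h3]
  refine Finset.sum_congr_of_eq_on_inter (fun b _ hb => h b ?_) (fun b _ hb => hn b ?_)
    fun _ _ _ => rfl
  · simp at hb; omega
  · simp at hb; omega

theorem sum_natK_zero_mul (f : ℕ → ℝ) :
    ∑ b ∈ Finset.range (n + 1), c.natK 0 b * f b = c.natK 0 0 * f 0 + c.natK 0 1 * f 1 :=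
  sum_range_eq_zero_add (fun b hb => by rw [c.natK_eq_zero_of_lt_right _ hb, zero_mul])
    fun b hb => by rw [c.natK_eq_zero (by omega), zero_mul]

theorem sum_natK_succ_mul (k : ℕ) (f : ℕ → ℝ) :
    ∑ b ∈ Finset.range (n + 1), c.natK (k + 1) b * f b =
      c.natK (k + 1) k * f k + c.natK (k + 1) (k + 1) * f (k + 1) +
        c.natK (k + 1) (k + 2) * f (k + 2) :=
  sum_range_eq_add_add k (fun b hb => by rw [c.natK_eq_zero_of_lt_right _ hb, zero_mul])
    fun b hb => by rw [c.natK_eq_zero (by omega), zero_mul]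

theorem sum_natK {a : ℕ} (ha : a ≤ n) : ∑ b ∈ Finset.range (n + 1), c.natK a b = 1 := by
  rw [← Fin.sum_univ_eq_sum_range (fun b => c.natK a b), ← c.K_rowSum ⟨a, by omega⟩]
  exact Finset.sum_congr rfl fun b _ => c.natK_val ⟨a, by omega⟩ b

theorem sum_natPi_mul_natK {b : ℕ} (hb : b ≤ n) :
    ∑ a ∈ Finset.range (n + 1), c.natPi a * c.natK a b = c.natPi b := by
  rw [← Fin.sum_univ_eq_sum_range (fun a => c.natPi a * c.natK a b),
    show c.natPi b = _ from c.natPi_val ⟨b, by omega⟩, ← c.pi_stat ⟨b, by omega⟩]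
  refine Finset.sum_congr rfl fun a _ => ?_
  rw [natPi_val, show c.natK a b = _ from c.natK_val a ⟨b, by omega⟩]

theorem natPi_mul_natK_succ (k : ℕ) :
    c.natPi k * c.natK k (k + 1) = c.natPi (k + 1) * c.natK (k + 1) k := by
  induction k with
  | zero =>
    have h1 := c.sum_natPi_mul_natK (Nat.zero_le n)
    have h2 := c.sum_natK_zero_mul 1
    simp only [Pi.one_apply, mul_one, c.sum_natK (Nat.zero_le n)] at h2
    rw [sum_range_eq_zero_add (fun b hb => by rw [c.natK_eq_zero_of_lt_left hb, mul_zero])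
      (fun b hb => by rw [c.natK_eq_zero (by omega), mul_zero])] at h1
    linear_combination c.natPi 0 * -h2 - h1
  | succ k ih =>
    rcases le_or_gt (k + 1) n with hk | hk
    · have h1 := c.sum_natPi_mul_natK hk
      have h2 := c.sum_natK_succ_mul k 1
      simp only [Pi.one_apply, mul_one, c.sum_natK hk] at h2
      rw [sum_range_eq_add_add k (fun b hb => by rw [c.natK_eq_zero_of_lt_left hb, mul_zero])
        (fun b hb => by rw [c.natK_eq_zero (by omega), mul_zero])] at h1
      linear_combination ih - c.natPi (k + 1) * h2 - h1
    · rw [c.natK_eq_zero_of_lt_left hk, c.natK_eq_zero_of_lt_right (k + 1 + 1) hk]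
      simp

/-- Detailed balance. -/
theorem natPi_mul_natK_comm (a b : ℕ) : c.natPi a * c.natK a b = c.natPi b * c.natK b a := by
  rcases lt_trichotomy a b with h | h | h
  · rcases eq_or_ne b (a + 1) with rfl | h'
    · exact c.natPi_mul_natK_succ a
    · rw [c.natK_eq_zero (by omega), c.natK_eq_zero (by omega), mul_zero, mul_zero]
  · rw [h]
  · rcases eq_or_ne a (b + 1) with rfl | h'
    · exact (c.natPi_mul_natK_succ b).symm
    · rw [c.natK_eq_zero (by omega), c.natK_eq_zero (by omega), mul_zero, mul_zero]

/-- `bdGreen` solves the Poisson equation. -/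
theorem bdGreen_sub_sum_natK (g : ℕ → ℝ) {j x : ℕ} (hj : j ≤ n) (hx : x < j) :
    bdGreen c.natPi c.natE j g x -
      ∑ b ∈ Finset.range (n + 1), c.natK x b * bdGreen c.natPi c.natE j g b = g x := by
  have hpi := (c.natPi_pos (hx.le.trans hj)).ne'
  have hE := (c.natE_pos (hx.trans_le hj)).ne'
  have hg := bdGreen_eq_add_succ c.natPi c.natE g hx
  have hrow := c.sum_natK (hx.le.trans hj)
  refine mul_left_cancel₀ hpi ?_
  rw [← sub_eq_iff_eq_add, eq_div_iff hE] at hg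
  cases x with
  | zero =>
    have h2 := c.sum_natK_zero_mul 1
    simp only [Pi.one_apply, mul_one, hrow] at h2
    rw [sum_natK_zero_mul]
    simp only [natE, zero_add, Finset.sum_range_one] at hg
    linear_combination c.natPi 0 * bdGreen c.natPi c.natE j g 0 * h2 + hg
  | succ k =>
    have hE' := (c.natE_pos (show k < n by omega)).ne'
    have hg' := bdGreen_eq_add_succ c.natPi c.natE g (show k < j by omega)
    rw [← sub_eq_iff_eq_add, eq_div_iff hE'] at hg'
    have h2 := c.sum_natK_succ_mul k 1
    have h3 := c.natPi_mul_natK_succ k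
    simp only [Pi.one_apply, mul_one, hrow] at h2
    rw [sum_natK_succ_mul]
    rw [Finset.sum_range_succ] at hg
    set G := bdGreen c.natPi c.natE j g
    simp only [natE] at hg hg'
    linear_combination c.natPi (k + 1) * G (k + 1) * h2 + hg - hg' + (G k - G (k + 1)) * h3

/-! ### Moments of the hitting times -/

theorem killed_nonneg (j x y : Fin (n + 1)) : 0 ≤ c.killed j x y := by
  simp only [killed, Matrix.of_apply]
  split_ifs
  exacts [le_rfl, c.K_nonneg x y]

/-- Before hitting `j`, a chain started below `j` only sees the states below `j`. -/
theorem killed_eq_zero {j x y : Fin (n + 1)} (hx : x < j) (hy : ¬ y < j) :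
    c.killed j x y = 0 := by
  simp only [killed, Matrix.of_apply]
  split_ifs with h
  · rfl
  · rw [← natK_val]
    refine c.natK_eq_zero ?_
    simp only [not_or, Fin.ext_iff, Fin.lt_def] at *
    omega

theorem killed_pow_mulVec_mono {j : Fin (n + 1)} {f g : Fin (n + 1) → ℝ}
    (h : ∀ x < j, f x ≤ g x) (m : ℕ) :
    ∀ x < j, (c.killed j ^ m *ᵥ f) x ≤ (c.killed j ^ m *ᵥ g) x := by
  induction m with
  | zero => simpa using h
  | succ m ih =>
    intro x hx
    rw [pow_succ', ← Matrix.mulVec_mulVec, ← Matrix.mulVec_mulVec]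
    simp only [mulVec, dotProduct] at ih ⊢
    refine Finset.sum_le_sum fun y _ => ?_
    by_cases hy : y < j
    · exact mul_le_mul_of_nonneg_left (ih y hy) (c.killed_nonneg j x y)
    · simp [c.killed_eq_zero hx hy]

theorem killed_pow_mulVec_congr {j : Fin (n + 1)} {f g : Fin (n + 1) → ℝ}
    (h : ∀ x < j, f x = g x) (m : ℕ) {x : Fin (n + 1)} (hx : x < j) :
    (c.killed j ^ m *ᵥ f) x = (c.killed j ^ m *ᵥ g) x :=
  le_antisymm (c.killed_pow_mulVec_mono (fun y hy => (h y hy).le) m x hx)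
    (c.killed_pow_mulVec_mono (fun y hy => (h y hy).ge) m x hx)

/-- `E_x[g(X_m); τ_j > m]` for a function `g` on `ℕ`. -/
def killedMean (j x : Fin (n + 1)) (g : ℕ → ℝ) (m : ℕ) : ℝ :=
  (c.killed j ^ m *ᵥ fun y : Fin (n + 1) => g y) x

@[simp]
theorem killedMean_zero (j x : Fin (n + 1)) (g : ℕ → ℝ) : c.killedMean j x g 0 = g x := by
  simp [killedMean]

theorem killedMean_one {j x : Fin (n + 1)} (hx : x ≠ j) : c.killedMean j x 1 = c.hitSurv j x := by
  ext m
  simp [killedMean, hitSurv, hx, mulVec, dotProduct]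

theorem killedMean_nonneg {j x : Fin (n + 1)} (hx : x < j) {g : ℕ → ℝ} (hg : ∀ k, 0 ≤ g k)
    (m : ℕ) : 0 ≤ c.killedMean j x g m := by
  refine le_trans (le_of_eq ?_)
    (c.killed_pow_mulVec_mono (f := 0) (g := fun y => g y) (fun y _ => hg y) m x hx)
  simp

theorem killedMean_le_mul {j x : Fin (n + 1)} (hx : x < j) {f g : ℕ → ℝ} {C : ℝ}
    (h : ∀ k < (j : ℕ), f k ≤ C * g k) (m : ℕ) :
    c.killedMean j x f m ≤ C * c.killedMean j x g m := by
  refine (c.killed_pow_mulVec_mono (g := C • fun y : Fin (n + 1) => g y)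
    (fun y hy => h y hy) m x hx).trans (le_of_eq ?_)
  rw [Matrix.mulVec_smul]
  rfl

theorem killedMean_eq_sub {j x : Fin (n + 1)} (hx : x < j) (g : ℕ → ℝ) (m : ℕ) :
    c.killedMean j x g m =
      c.killedMean j x (bdGreen c.natPi c.natE j g) m -
        c.killedMean j x (bdGreen c.natPi c.natE j g) (m + 1) := by
  set f := bdGreen c.natPi c.natE j g with hf
  unfold killedMean
  rw [pow_succ, ← Matrix.mulVec_mulVec, ← Pi.sub_apply, ← Matrix.mulVec_sub]
  refine c.killed_pow_mulVec_congr (fun y hy => ?_) m hx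
  have hjn : (j : ℕ) ≤ n := by omega
  rw [← c.bdGreen_sub_sum_natK g hjn hy, ← hf, Pi.sub_apply,
    ← Fin.sum_univ_eq_sum_range (fun b => c.natK y b * f b)]
  refine congrArg _ (Finset.sum_congr rfl fun z _ => ?_)
  by_cases hz : z < j
  · simp [killed, hy.ne, hz.ne]
  · have : f z = 0 := bdGreen_eq_zero _ _ _ (by simpa using hz)
    simp [this]

theorem exists_le_mul_of_pos {f g : ℕ → ℝ} {j : ℕ} (hf : ∀ k < j, 0 ≤ f k)
    (hg : ∀ k < j, 0 < g k) : ∃ C, 0 ≤ C ∧ ∀ k < j, f k ≤ C * g k := by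
  have h0 : ∀ k ∈ Finset.range j, 0 ≤ f k / g k := fun k hk =>
    div_nonneg (hf k (Finset.mem_range.1 hk)) (hg k (Finset.mem_range.1 hk)).le
  refine ⟨∑ k ∈ Finset.range j, f k / g k, Finset.sum_nonneg h0, fun k hk => ?_⟩
  rw [← div_le_iff₀ (hg k hk)]
  exact Finset.single_le_sum h0 (Finset.mem_range.2 hk)

/-- The function `k ↦ E_k τ_j`. -/
def meanFun (j : ℕ) : ℕ → ℝ := bdGreen c.natPi c.natE j 1

theorem natPi_pos_of_lt {j : Fin (n + 1)} (k : ℕ) (hk : k < j) : 0 < c.natPi k :=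
  c.natPi_pos (by omega)

theorem natE_pos_of_lt {j : Fin (n + 1)} (k : ℕ) (hk : k < j) : 0 < c.natE k :=
  c.natE_pos (by omega)

theorem meanFun_nonneg (j : Fin (n + 1)) (k : ℕ) : 0 ≤ c.meanFun j k :=
  bdGreen_nonneg c.natPi_pos_of_lt c.natE_pos_of_lt (fun _ => zero_le_one) k

theorem meanFun_pos {j : Fin (n + 1)} {k : ℕ} (hk : k < j) : 0 < c.meanFun j k :=
  bdGreen_pos c.natPi_pos_of_lt c.natE_pos_of_lt (fun _ _ => zero_lt_one) hk

section Moments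

variable {i j : Fin (n + 1)}

theorem hitSurv_nonneg (hij : i < j) (m : ℕ) : 0 ≤ c.hitSurv j i m := by
  rw [← c.killedMean_one hij.ne]
  exact c.killedMean_nonneg hij (fun _ => zero_le_one) m

theorem hasSum_hitSurv (hij : i < j) : HasSum (c.hitSurv j i) (c.meanFun j i) := by
  obtain ⟨C, -, hC⟩ := exists_le_mul_of_pos (j := j) (fun k _ => c.meanFun_nonneg j k)
    (g := 1) (fun _ _ => zero_lt_one)
  have := hasSum_of_telescope (c.hitSurv_nonneg hij)
    (c.killedMean_nonneg hij (c.meanFun_nonneg j)) (C := C)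
    (fun m => by rw [← c.killedMean_one hij.ne]; exact c.killedMean_eq_sub hij 1 m)
    (fun m => by rw [← c.killedMean_one hij.ne]; exact c.killedMean_le_mul hij hC m)
  simpa using this

theorem hasSum_succ_mul_hitSurv (hij : i < j) :
    HasSum (fun m : ℕ => ((m : ℝ) + 1) * c.hitSurv j i m)
      (bdGreen c.natPi c.natE j (c.meanFun j) i) := by
  have hw := bdGreen_nonneg (j := j) c.natPi_pos_of_lt c.natE_pos_of_lt (c.meanFun_nonneg j)
  obtain ⟨C, -, hC⟩ := exists_le_mul_of_pos (j := j) (fun k _ => c.meanFun_nonneg j k)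
    (g := 1) (fun _ _ => zero_lt_one)
  obtain ⟨D, hD, hWD⟩ := exists_le_mul_of_pos (j := j) (fun k _ => hw k)
    (fun k => c.meanFun_pos (k := k))
  have := hasSum_succ_mul_of_telescope (c.hitSurv_nonneg hij)
    (c.killedMean_nonneg hij (c.meanFun_nonneg j)) (c.killedMean_nonneg hij hw) hD
    (fun m => by rw [← c.killedMean_one hij.ne]; exact c.killedMean_eq_sub hij 1 m)
    (fun m => c.killedMean_eq_sub hij (c.meanFun j) m)
    (fun m => by rw [← c.killedMean_one hij.ne]; exact c.killedMean_le_mul hij hC m)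
    (fun m => c.killedMean_le_mul hij hWD m)
  simpa using this

theorem hitMean_eq (hij : i < j) : c.hitMean j i = c.meanFun j i :=
  (c.hasSum_hitSurv hij).tsum_eq

theorem hitMeanC_eq (hij : i < j) : c.hitMeanC j i = c.meanFun j i := by
  have h := c.hasSum_hitSurv hij
  have h0 : ∀ m : ℕ, ((m + 0).factorial / m.factorial : ℝ) * c.hitSurv j i m = c.hitSurv j i m :=
    fun m => by
      have : (m.factorial : ℝ) ≠ 0 := by positivity
      simp [this]
  have := integral_pow_mul_tsum_poisson (c.hitSurv_nonneg hij) 0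
    (by simpa only [h0] using h.summable)
  simp only [h0, h.tsum_eq, pow_zero, one_mul] at this
  exact this

theorem hitVarC_eq (hij : i < j) : c.hitVarC j i =
    2 * bdGreen c.natPi c.natE j (c.meanFun j) i - c.meanFun j i ^ 2 := by
  have h := c.hasSum_succ_mul_hitSurv hij
  have h0 : ∀ m : ℕ, ((m + 1).factorial / m.factorial : ℝ) * c.hitSurv j i m =
      ((m : ℝ) + 1) * c.hitSurv j i m := fun m => by
    have : (m.factorial : ℝ) ≠ 0 := by positivity
    rw [Nat.factorial_succ]
    push_cast
    field_simp
  have := integral_pow_mul_tsum_poisson (c.hitSurv_nonneg hij) 1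
    (by simpa only [h0] using h.summable)
  simp only [h0, h.tsum_eq, pow_one] at this
  rw [hitVarC, hitMeanC_eq c hij, ← this, ← integral_const_mul]
  simp only [hitSurvC, mul_assoc]

theorem hitVar_eq (hij : i < j) : c.hitVar j i = c.hitVarC j i - c.meanFun j i := by
  have h := ((c.hasSum_succ_mul_hitSurv hij).mul_left 2).sub (c.hasSum_hitSurv hij)
  have h1 : (fun m : ℕ => (2 * (m : ℝ) + 1) * c.hitSurv j i m) =
      fun m : ℕ => 2 * (((m : ℝ) + 1) * c.hitSurv j i m) - c.hitSurv j i m := by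
    ext m; ring
  rw [hitVar, h1, h.tsum_eq, c.hitVarC_eq hij, c.hitMean_eq hij]
  ring

end Moments

/-! ### Bounds -/

/-- `π([0,k])` for a natural number `k`. -/
def natLow (k : ℕ) : ℝ := ∑ l ∈ Finset.range (k + 1), c.natPi l

theorem natLow_mono : Monotone c.natLow := fun a b h =>
  Finset.sum_le_sum_of_subset_of_nonneg (by simpa using h) fun k _ _ => c.natPi_nonneg k

theorem natPi_le_natLow (k : ℕ) : c.natPi k ≤ c.natLow k :=
  Finset.single_le_sum (fun l _ => c.natPi_nonneg l) (by simp)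

theorem natLow_pos (k : ℕ) : 0 < c.natLow k :=
  (c.natPi_pos (Nat.zero_le n)).trans_le ((c.natPi_le_natLow 0).trans (c.natLow_mono k.zero_le))

theorem piLow_eq (x : Fin (n + 1)) : c.piLow x = c.natLow x := by
  have h : c.piLow x = ∑ l ∈ Finset.range (n + 1), if l ≤ (x : ℕ) then c.natPi l else 0 := by
    rw [← Fin.sum_univ_eq_sum_range (fun l => if l ≤ (x : ℕ) then c.natPi l else 0)]
    simp only [piLow, natPi_val, Fin.le_def]
  rw [h, ← Finset.sum_filter]
  refine Finset.sum_congr ?_ fun _ _ => rfl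
  ext l
  simp only [Finset.mem_filter, Finset.mem_range]
  omega

theorem meanFun_eq (j k : ℕ) :
    c.meanFun j k = ∑ m ∈ Finset.Ico k j, c.natLow m / c.natE m := by
  simp [meanFun, bdGreen, natLow]

theorem hitVarC_eq_sum {i j : Fin (n + 1)} (hij : i < j) : c.hitVarC j i =
    ∑ k ∈ Finset.Ico (i : ℕ) j, ((c.natLow k / c.natE k) ^ 2 +
      2 / c.natE k * ∑ m ∈ Finset.range k, c.natLow m * (c.natLow m / c.natE m)) := by
  rw [c.hitVarC_eq hij]
  exact two_mul_bdGreen_sub_sq _ _ (by omega)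

theorem subIK_eq (j : Fin (n + 1)) :
    c.subIK j = 1 - Matrix.of fun a b : Fin (j : ℕ) => c.natK a b := by
  ext a b
  have h := c.natK_val (Fin.castLE j.isLt.le a) (Fin.castLE j.isLt.le b)
  simp only [Fin.val_castLE] at h
  simp [subIK, Matrix.one_apply, h]

theorem subIK_mulVec (j : Fin (n + 1)) {f : ℕ → ℝ} (hf : ∀ k, (j : ℕ) ≤ k → f k = 0)
    (a : Fin (j : ℕ)) : (c.subIK j *ᵥ fun b => f b) a =
      f a - ∑ b ∈ Finset.range (n + 1), c.natK a b * f b := by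
  rw [subIK_eq, Matrix.sub_mulVec, Matrix.one_mulVec, Pi.sub_apply]
  simp only [mulVec, dotProduct, Matrix.of_apply]
  rw [Fin.sum_univ_eq_sum_range (fun b => c.natK a b * f b)]
  congr 1
  refine Finset.sum_subset (Finset.range_subset_range.2 (by omega)) fun b _ hb => ?_
  rw [hf b (by simpa using hb), mul_zero]

theorem natK_nonneg (a b : ℕ) : 0 ≤ c.natK a b := by
  unfold natK
  split_ifs
  exacts [c.K_nonneg _ _, le_rfl]

theorem pos_of_mem_eigSet_subIK {j : Fin (n + 1)} {x : ℝ} (hx : x ∈ eigSet (c.subIK j)) :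
    0 < x := by
  rw [subIK_eq] at hx
  refine pos_of_mem_eigSet_one_sub (Q := Matrix.of fun a b : Fin (j : ℕ) => c.natK a b)
    (fun a b => c.natK_nonneg a b)
    (u := fun a : Fin (j : ℕ) => c.meanFun j a) (fun a => c.meanFun_pos a.isLt) ?_ hx
  ext a
  rw [← subIK_eq, c.subIK_mulVec j (f := c.meanFun j) (fun k hk => bdGreen_eq_zero _ _ _ hk)]
  exact c.bdGreen_sub_sum_natK 1 (by omega) a.isLt

/-- The mean passage time to `k + 1`, averaged over `π` on `[0,k]`, is at most the relaxation
time. -/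
theorem mul_sum_natPi_mul_meanFun_le {j : Fin (n + 1)} {lam : ℝ}
    (hlam : IsSmallestEig (c.subIK j) lam) {k : ℕ} (hk : k < j) :
    lam * ∑ l ∈ Finset.range (k + 1), c.natPi l * c.meanFun (k + 1) l ≤ c.natLow k := by
  set f := c.meanFun (k + 1) with hf
  have hl := c.pos_of_mem_eigSet_subIK hlam.1
  have hf0 : ∀ l, k + 1 ≤ l → f l = 0 := fun l hl => bdGreen_eq_zero _ _ _ hl
  have hfpos : ∀ l < k + 1, 0 < f l := fun l hl => bdGreen_pos
    (fun m _ => c.natPi_pos (by omega)) (fun m _ => c.natE_pos (by omega))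
    (fun _ _ => zero_lt_one) hl
  have hsymm : ∀ a b : Fin (j : ℕ), c.natPi a * c.subIK j a b = c.natPi b * c.subIK j b a :=
      fun a b => by
    have := c.natPi_mul_natK_comm a b
    rcases eq_or_ne a b with rfl | hab
    · rfl
    · simp [subIK_eq, hab, hab.symm, this]
  have key := mul_sum_sq_le_of_le_eigSet (fun a : Fin (j : ℕ) => c.natPi_pos_of_lt _ a.isLt) hsymm
    hlam.2 (fun a => f a)
  have hres : ∀ g : ℕ → ℝ, (∀ l, k + 1 ≤ l → g l = 0) →
      ∑ a : Fin (j : ℕ), g a = ∑ l ∈ Finset.range (k + 1), g l := fun g hg => by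
    rw [Fin.sum_univ_eq_sum_range g]
    exact (Finset.sum_subset (Finset.range_subset_range.2 (by omega)) fun l _ hl =>
      hg l (by simpa using hl)).symm
  have h1 : ∑ a : Fin (j : ℕ), c.natPi a * f a * (c.subIK j *ᵥ fun b => f b) a =
      ∑ l ∈ Finset.range (k + 1), c.natPi l * f l := by
    rw [← hres _ fun l hl => by rw [hf0 l hl, mul_zero]]
    refine Finset.sum_congr rfl fun a _ => ?_
    rw [c.subIK_mulVec j (fun l hl => hf0 l (by omega))]
    rcases lt_or_ge (a : ℕ) (k + 1) with ha | ha
    · have := c.bdGreen_sub_sum_natK 1 (show k + 1 ≤ n by omega) ha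
      rw [hf, meanFun, this]
      simp
    · rw [hf0 _ ha]; simp
  rw [h1, hres (fun l => c.natPi l * f l ^ 2) fun l hl => by simp [hf0 l hl]] at key
  set T := ∑ l ∈ Finset.range (k + 1), c.natPi l * f l with hT
  have hTpos : 0 < T := Finset.sum_pos
    (fun l hl => by
      have := Finset.mem_range.1 hl
      exact mul_pos (c.natPi_pos (by omega)) (hfpos l this)) ⟨0, by simp⟩
  have hCS : T ^ 2 ≤ c.natLow k * ∑ l ∈ Finset.range (k + 1), c.natPi l * f l ^ 2 :=
    Finset.sum_sq_le_sum_mul_sum_of_sq_le_mul _ (fun l _ => c.natPi_nonneg l)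
      (fun l _ => mul_nonneg (c.natPi_nonneg l) (sq_nonneg _))
      fun l _ => by rw [mul_pow, sq (c.natPi l), mul_assoc]
  have h2 := mul_le_mul_of_nonneg_left key (c.natLow_pos k).le
  have h3 := mul_le_mul_of_nonneg_left hCS hl.le
  refine le_of_mul_le_mul_right ?_ hTpos
  linarith

theorem hitVarC_le {i j : Fin (n + 1)} (hij : i < j) {lam : ℝ}
    (hlam : IsSmallestEig (c.subIK j) lam) : c.hitVarC j i ≤ 2 / lam * c.meanFun j i := by
  have hl := c.pos_of_mem_eigSet_subIK hlam.1
  rw [c.hitVarC_eq_sum hij, meanFun_eq, Finset.mul_sum]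
  refine Finset.sum_le_sum fun k hk => ?_
  have hk' := (Finset.mem_Ico.1 hk).2
  have hE := c.natE_pos_of_lt k hk'
  have h := c.mul_sum_natPi_mul_meanFun_le hlam hk'
  unfold meanFun at h
  rw [sum_mul_bdGreen_one _ _ (Nat.lt_succ_self k), bdGreen_eq_add_succ _ _ _ (Nat.lt_succ_self k),
    bdGreen_eq_zero _ _ _ le_rfl] at h
  simp only [Pi.one_apply, mul_one, add_zero] at h
  change lam * (c.natLow k * (c.natLow k / c.natE k) +
    ∑ m ∈ Finset.range k, c.natLow m * (c.natLow m / c.natE m)) ≤ c.natLow k at h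
  have h1 := mul_le_mul_of_nonneg_left ((le_div_iff₀' hl).2 h) (div_nonneg zero_le_two hE.le)
  have h2 : 0 ≤ (c.natLow k / c.natE k) ^ 2 := sq_nonneg _
  calc _ ≤ 2 / c.natE k * (c.natLow k * (c.natLow k / c.natE k) +
        ∑ m ∈ Finset.range k, c.natLow m * (c.natLow m / c.natE m)) := by
        rw [mul_add, show 2 / c.natE k * (c.natLow k * (c.natLow k / c.natE k)) =
          2 * (c.natLow k / c.natE k) ^ 2 by ring]
        linarith
    _ ≤ _ := h1
    _ = _ := by ring

theorem mul_sq_meanFun_le_sum {i j : Fin (n + 1)} (hij : i < j) {a : ℕ → ℝ} {b : ℝ}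
    (hb : 0 ≤ b) (hb1 : b ≤ 1) (ha : ∀ k < (j : ℕ), b * (c.natLow k / c.natE k) ^ 2 ≤ a k) :
    b * (c.natLow i / c.natLow ((j : ℕ) - 1)) * c.meanFun j i ^ 2 ≤
      ∑ k ∈ Finset.Ico (i : ℕ) j, (a k +
        2 / c.natE k * ∑ m ∈ Finset.range k, c.natLow m * (c.natLow m / c.natE m)) := by
  have hr0 : 0 ≤ c.natLow i / c.natLow ((j : ℕ) - 1) :=
    div_nonneg (c.natLow_pos _).le (c.natLow_pos _).le
  have hr1 : c.natLow i / c.natLow ((j : ℕ) - 1) ≤ 1 :=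
    div_le_one_of_le₀ (c.natLow_mono (by omega)) (c.natLow_pos _).le
  rw [meanFun_eq]
  refine mul_sq_sum_le_sum_add (by omega) (fun k _ => (c.natLow_pos k).le)
    c.natE_pos_of_lt (fun k _ hk => c.natLow_mono hk) (fun k hk => ?_) (fun k hk => ?_)
  · have h1 := mul_le_mul_of_nonneg_left (c.natLow_mono (show k ≤ (j : ℕ) - 1 by omega)) hr0
    rw [div_mul_cancel₀ _ (c.natLow_pos _).ne'] at h1
    have h2 := mul_nonneg hr0 (c.natLow_pos k).le
    nlinarith
  · refine le_trans (mul_le_mul_of_nonneg_right ?_ (sq_nonneg _)) (ha k hk)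
    exact mul_le_of_le_one_right hb hr1

theorem mul_sq_natLow_div_le {d : ℝ} (hd : ∀ x, d ≤ c.K x x) {k : ℕ} (hk : k < n) :
    d * (c.natLow k / c.natE k) ^ 2 ≤ (c.natLow k / c.natE k) ^ 2 - c.natLow k / c.natE k := by
  have hE := c.natE_pos hk
  have hkk : d ≤ c.natK k k := (hd ⟨k, by omega⟩).trans_eq (c.natK_val ⟨k, _⟩ ⟨k, _⟩).symm
  have hrow : c.natK k k + c.natK k (k + 1) ≤ 1 := by
    rw [← c.sum_natK hk.le, ← Finset.sum_pair (show k ≠ k + 1 by omega)]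
    refine Finset.sum_le_sum_of_subset_of_nonneg (fun b hb => ?_) fun b _ _ => c.natK_nonneg k b
    simp at hb ⊢
    omega
  have hK := c.natK_nonneg k (k + 1)
  have h1 : c.natE k ≤ (1 - d) * c.natLow k :=
    calc c.natE k = c.natK k (k + 1) * c.natPi k := mul_comm _ _
      _ ≤ c.natK k (k + 1) * c.natLow k := mul_le_mul_of_nonneg_left (c.natPi_le_natLow k) hK
      _ ≤ _ := mul_le_mul_of_nonneg_right (by linarith) (c.natLow_pos k).le
  have h2 : 1 ≤ (1 - d) * (c.natLow k / c.natE k) := by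
    rw [← mul_div_assoc, one_le_div hE]
    exact h1
  have h3 : 0 < c.natLow k / c.natE k := div_pos (c.natLow_pos k) hE
  nlinarith

end BDChain

/-- Lemma `l-hit2`.  For `i < j`, with `λ_j` the smallest eigenvalue of
the principal submatrix of `I − K` indexed by `0,…,j−1` and `δ = min_i K(i,i)`:
`(π([0,i])/(2π([0,j−1])))(E_i τ̃_j)² ≤ Var_i τ̃_j ≤ (2/λ_j) E_i τ̃_j`,
`(δπ([0,i])/(2π([0,j−1])))(E_i τ_j)² ≤ Var_i τ_j ≤ (2/λ_j) E_i τ_j`, and in particular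
`E_i τ_j = E_i τ̃_j ≤ 4π([0,j−1])/(π([0,i]) λ_j)`. -/
theorem birth_death_hitting_time_variance_bounds
    {n : ℕ} (c : BDChain n) (i j : Fin (n + 1)) (hij : i < j)
    (lam : ℝ) (hlam : IsSmallestEig (c.subIK j) lam) :
    (c.piLow i / (2 * c.piLow (j - 1))) * (c.hitMeanC j i) ^ 2 ≤ c.hitVarC j i ∧
    c.hitVarC j i ≤ (2 / lam) * c.hitMeanC j i ∧
    ((Finset.univ.inf' Finset.univ_nonempty fun x : Fin (n + 1) => c.K x x) * c.piLow i /
        (2 * c.piLow (j - 1))) * (c.hitMean j i) ^ 2 ≤ c.hitVar j i ∧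
    c.hitVar j i ≤ (2 / lam) * c.hitMean j i ∧
    c.hitMean j i = c.hitMeanC j i ∧
    c.hitMeanC j i ≤ 4 * c.piLow (j - 1) / (c.piLow i * lam) := by
  have hl := c.pos_of_mem_eigSet_subIK hlam.1
  have hj1 : ((j - 1 : Fin (n + 1)) : ℕ) = (j : ℕ) - 1 :=
    Fin.val_sub_one_of_ne_zero (Fin.ne_zero_of_lt hij)
  have hm : 0 < c.meanFun j i := c.meanFun_pos hij
  have hr : 0 < c.natLow i / c.natLow ((j : ℕ) - 1) := div_pos (c.natLow_pos _) (c.natLow_pos _)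
  rw [c.hitMean_eq hij, c.hitMeanC_eq hij, c.hitVar_eq hij, c.piLow_eq, c.piLow_eq, hj1]
  set d := Finset.univ.inf' Finset.univ_nonempty fun x : Fin (n + 1) => c.K x x
  have hd : ∀ x, d ≤ c.K x x := fun x => Finset.inf'_le _ (Finset.mem_univ x)
  have hd0 : 0 ≤ d := Finset.le_inf' _ _ fun x _ => c.K_nonneg x x
  have hd1 : d ≤ 1 := (hd 0).trans <| by
    rw [← c.K_rowSum 0]
    exact Finset.single_le_sum (fun y _ => c.K_nonneg 0 y) (Finset.mem_univ 0)
  have hupper := c.hitVarC_le hij hlam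
  have hlower : c.natLow i / c.natLow ((j : ℕ) - 1) * c.meanFun j i ^ 2 ≤ c.hitVarC j i := by
    have := c.mul_sq_meanFun_le_sum hij zero_le_one le_rfl fun k _ => (one_mul _).le
    rwa [one_mul, ← c.hitVarC_eq_sum hij] at this
  have hlowerD : d * (c.natLow i / c.natLow ((j : ℕ) - 1)) * c.meanFun j i ^ 2 ≤
      c.hitVarC j i - c.meanFun j i := by
    refine (c.mul_sq_meanFun_le_sum hij hd0 hd1
      fun k hk => c.mul_sq_natLow_div_le hd (by omega)).trans_eq ?_
    rw [c.hitVarC_eq_sum hij, c.meanFun_eq, ← Finset.sum_sub_distrib]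
    exact Finset.sum_congr rfl fun k _ => by ring
  have hhalf : c.natLow i / (2 * c.natLow ((j : ℕ) - 1)) * c.meanFun j i ^ 2 ≤ c.hitVarC j i := by
    have : 0 ≤ c.natLow i / c.natLow ((j : ℕ) - 1) * c.meanFun j i ^ 2 := by positivity
    refine le_trans ?_ hlower
    rw [mul_comm 2, ← div_div]
    linarith
  refine ⟨hhalf, hupper, ?_, by linarith, rfl, ?_⟩
  · have : 0 ≤ d * (c.natLow i / c.natLow ((j : ℕ) - 1)) * c.meanFun j i ^ 2 := by positivity
    refine le_trans ?_ hlowerD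
    rw [mul_comm 2, ← div_div, mul_div_assoc]
    linarith
  · have h1 := c.natLow_pos i
    have h2 := c.natLow_pos ((j : ℕ) - 1)
    have h3 := hhalf.trans hupper
    rw [sq, ← mul_assoc] at h3
    have h4 := le_of_mul_le_mul_right h3 hm
    rw [div_mul_eq_mul_div, div_le_div_iff₀ (by positivity) hl] at h4
    rw [le_div_iff₀ (by positivity)]
    linarith

end
end

section
/- Let K be the transition matrix of an irreducible birth and death chain on {0,1,...,n} and let τ̃_i be the continuous-time hitting time of state i. Then for every 0 < i ≤ n and a ∈ (0,1), P_0(τ̃_i > a·E_0 τ̃_i) ≥ min{ e^{−√a}, (1−a)² / (√a + (1−a)²) }. -/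
open scoped BigOperators
open Filter Matrix Polynomial MeasureTheory

noncomputable section

/-- The one-step operator of a birth and death walk on `{0, …, N - 1}` killed on reaching `N`. -/
def killedStep (N : ℕ) (p q : ℕ → ℝ) : Module.End ℝ (ℕ → ℝ) where
  toFun f x := if x < N then (1 - p x - q x) * f x + p x * f (x + 1) + q x * f (x - 1) else 0
  map_add' f g := by
    ext x
    simp only [Pi.add_apply]
    split_ifs <;> ring
  map_smul' a f := by
    ext x
    simp only [Pi.smul_apply, smul_eq_mul, RingHom.id_apply]
    split_ifs <;> ring

/-- The transition probabilities of an irreducible birth and death walk on `{0, …, N - 1}`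
that exits only upwards, from `N - 1`. -/
structure IsKilledWalk (N : ℕ) (p q : ℕ → ℝ) : Prop where
  p_pos : ∀ x < N, 0 < p x
  q_pos : ∀ x, x + 1 < N → 0 < q (x + 1)
  q_zero : q 0 = 0
  add_le : ∀ x < N, p x + q x ≤ 1

/-- The indicator function of `{0, …, N - 1}`. -/
def indBelow (N : ℕ) (x : ℕ) : ℝ := if x < N then 1 else 0

/-- The probability that the killed walk started at `x` survives `m` steps. -/
def walkSurv (N : ℕ) (p q : ℕ → ℝ) (m x : ℕ) : ℝ := (killedStep N p q ^ m) (indBelow N) x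

/-- The reversible weights of a birth and death walk. -/
def walkWeight (p q : ℕ → ℝ) : ℕ → ℝ
  | 0 => 1
  | x + 1 => walkWeight p q x * p x / q (x + 1)

/-- The effective resistance between `x` and `N`. -/
def walkRes (N : ℕ) (p q : ℕ → ℝ) (x : ℕ) : ℝ :=
  ∑ z ∈ Finset.Ico x N, (walkWeight p q z * p z)⁻¹

/-- The Green operator of the killed walk. -/
def walkGreen (N : ℕ) (p q : ℕ → ℝ) (d : ℕ → ℝ) (x : ℕ) : ℝ :=
  ∑ y ∈ Finset.range N, walkWeight p q y * d y * walkRes N p q (max x y)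

lemma killedStep_apply {N : ℕ} {p q : ℕ → ℝ} (f : ℕ → ℝ) (x : ℕ) :
    killedStep N p q f x =
      if x < N then (1 - p x - q x) * f x + p x * f (x + 1) + q x * f (x - 1) else 0 := rfl

lemma killedStep_pow_succ {N : ℕ} {p q : ℕ → ℝ} (m : ℕ) (f : ℕ → ℝ) :
    (killedStep N p q ^ (m + 1)) f = killedStep N p q ((killedStep N p q ^ m) f) := by
  rw [pow_succ', Module.End.mul_apply]

lemma killedStep_pow_succ' {N : ℕ} {p q : ℕ → ℝ} (m : ℕ) (f : ℕ → ℝ) :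
    (killedStep N p q ^ (m + 1)) f = (killedStep N p q ^ m) (killedStep N p q f) := by
  rw [pow_succ, Module.End.mul_apply]

lemma walkSurv_zero (N : ℕ) (p q : ℕ → ℝ) (x : ℕ) : walkSurv N p q 0 x = indBelow N x := rfl

lemma walkSurv_succ (N : ℕ) (p q : ℕ → ℝ) (m x : ℕ) :
    walkSurv N p q (m + 1) x = killedStep N p q (walkSurv N p q m) x := by
  unfold walkSurv
  rw [killedStep_pow_succ]

namespace IsKilledWalk

variable {N : ℕ} {p q : ℕ → ℝ}

lemma q_nonneg (h : IsKilledWalk N p q) {x : ℕ} (hx : x < N) : 0 ≤ q x := by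
  cases x with
  | zero => exact h.q_zero.ge
  | succ x => exact (h.q_pos x hx).le

lemma killedStep_mono (h : IsKilledWalk N p q) {f g : ℕ → ℝ} (hfg : ∀ x, f x ≤ g x) (x : ℕ) :
    killedStep N p q f x ≤ killedStep N p q g x := by
  simp only [killedStep_apply]
  split_ifs with hx
  · have h1 := mul_le_mul_of_nonneg_left (hfg x) (by linarith [h.add_le x hx] : 0 ≤ 1 - p x - q x)
    have h2 := mul_le_mul_of_nonneg_left (hfg (x + 1)) (h.p_pos x hx).le
    have h3 := mul_le_mul_of_nonneg_left (hfg (x - 1)) (h.q_nonneg hx)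
    linarith
  · exact le_rfl

lemma killedStep_pow_mono (h : IsKilledWalk N p q) {f g : ℕ → ℝ} (hfg : ∀ x, f x ≤ g x)
    (m x : ℕ) : (killedStep N p q ^ m) f x ≤ (killedStep N p q ^ m) g x := by
  induction m generalizing x with
  | zero => exact hfg x
  | succ m ih =>
    rw [killedStep_pow_succ, killedStep_pow_succ]
    exact h.killedStep_mono ih x

lemma killedStep_pow_nonneg (h : IsKilledWalk N p q) {f : ℕ → ℝ} (hf : ∀ x, 0 ≤ f x)
    (m x : ℕ) : 0 ≤ (killedStep N p q ^ m) f x := by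
  simpa using h.killedStep_pow_mono (f := 0) hf m x

lemma indBelow_nonneg (N x : ℕ) : 0 ≤ indBelow N x := by
  unfold indBelow
  split_ifs <;> norm_num

lemma walkSurv_nonneg (h : IsKilledWalk N p q) (m x : ℕ) : 0 ≤ walkSurv N p q m x :=
  h.killedStep_pow_nonneg (indBelow_nonneg N) m x

lemma walkSurv_succ_le (h : IsKilledWalk N p q) (m x : ℕ) :
    walkSurv N p q (m + 1) x ≤ walkSurv N p q m x := by
  unfold walkSurv
  rw [killedStep_pow_succ']
  refine h.killedStep_pow_mono (fun y => ?_) m x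
  have hle : ∀ z, indBelow N z ≤ 1 := fun z => by unfold indBelow; split_ifs <;> norm_num
  by_cases hy : y < N
  · have h2 := mul_le_mul_of_nonneg_left (hle (y + 1)) (h.p_pos y hy).le
    have h3 := mul_le_mul_of_nonneg_left (hle (y - 1)) (h.q_nonneg hy)
    have h1 : indBelow N y = 1 := if_pos hy
    rw [killedStep_apply, if_pos hy, h1]
    linarith
  · rw [killedStep_apply, if_neg hy]
    exact indBelow_nonneg N y

lemma walkSurv_antitone (h : IsKilledWalk N p q) (x : ℕ) :
    Antitone fun m => walkSurv N p q m x :=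
  antitone_nat_of_succ_le fun m => h.walkSurv_succ_le m x

lemma walkSurv_le_one (h : IsKilledWalk N p q) (m x : ℕ) : walkSurv N p q m x ≤ 1 :=
  (h.walkSurv_antitone x (Nat.zero_le m)).trans <| by
    simp only [walkSurv_zero, indBelow]
    split_ifs <;> norm_num

lemma walkSurv_antitone_start (h : IsKilledWalk N p q) (m : ℕ) : Antitone (walkSurv N p q m) := by
  induction m with
  | zero =>
    intro x y hxy
    simp only [walkSurv_zero, indBelow]
    split_ifs <;> first | omega | norm_num
  | succ m ih =>
    refine antitone_nat_of_succ_le fun x => ?_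
    by_cases hx : x < N
    · refine (h.walkSurv_succ_le m (x + 1)).trans ?_
      rw [walkSurv_succ, killedStep_apply, if_pos hx]
      have h1 := mul_le_mul_of_nonneg_left (ih (Nat.le_succ x))
        (by linarith [h.add_le x hx] : 0 ≤ 1 - p x - q x)
      have h3 := mul_le_mul_of_nonneg_left (ih (by omega : x - 1 ≤ x + 1)) (h.q_nonneg hx)
      simp only [Nat.succ_eq_add_one] at h1
      linarith
    · rw [walkSurv_succ, walkSurv_succ, killedStep_apply, killedStep_apply, if_neg hx,
        if_neg (by omega)]

lemma walkWeight_pos (h : IsKilledWalk N p q) {x : ℕ} (hx : x < N) : 0 < walkWeight p q x := by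
  induction x with
  | zero => exact one_pos
  | succ x ih =>
    exact div_pos (mul_pos (ih (by omega)) (h.p_pos x (by omega))) (h.q_pos x hx)

lemma walkRes_nonneg (h : IsKilledWalk N p q) (x : ℕ) : 0 ≤ walkRes N p q x :=
  Finset.sum_nonneg fun z hz => by
    have hz := (Finset.mem_Ico.1 hz).2
    exact (inv_pos.2 (mul_pos (h.walkWeight_pos hz) (h.p_pos z hz))).le

lemma walkRes_succ {x : ℕ} (hx : x < N) :
    walkRes N p q x = (walkWeight p q x * p x)⁻¹ + walkRes N p q (x + 1) :=
  Finset.sum_eq_sum_Ico_succ_bot hx _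

lemma walkRes_pos (h : IsKilledWalk N p q) {x : ℕ} (hx : x < N) : 0 < walkRes N p q x := by
  rw [walkRes_succ hx]
  exact add_pos_of_pos_of_nonneg
    (inv_pos.2 (mul_pos (h.walkWeight_pos hx) (h.p_pos x hx))) (h.walkRes_nonneg _)

lemma walkGreen_eq_zero (d : ℕ → ℝ) {x : ℕ} (hx : N ≤ x) : walkGreen N p q d x = 0 :=
  Finset.sum_eq_zero fun y _ => by
    simp [walkRes, Finset.Ico_eq_empty_of_le (hx.trans (le_max_left x y))]

lemma walkGreen_nonneg (h : IsKilledWalk N p q) {d : ℕ → ℝ} (hd : ∀ x, 0 ≤ d x) (x : ℕ) :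
    0 ≤ walkGreen N p q d x :=
  Finset.sum_nonneg fun y hy => mul_nonneg
    (mul_nonneg (h.walkWeight_pos (Finset.mem_range.1 hy)).le (hd y)) (h.walkRes_nonneg _)

/-- The columns of the Green kernel are the potentials of unit masses. -/
lemma walkRes_max_sub (h : IsKilledWalk N p q) {x y : ℕ} (hx : x < N) (hy : y < N) :
    walkWeight p q y * (p x * (walkRes N p q (max x y) - walkRes N p q (max (x + 1) y)) +
      q x * (walkRes N p q (max x y) - walkRes N p q (max (x - 1) y))) = if x = y then 1 else 0 := by
  have hW := (h.walkWeight_pos hx).ne'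
  have hp := (h.p_pos x hx).ne'
  rcases lt_trichotomy x y with hxy | rfl | hxy
  · rw [if_neg hxy.ne, max_eq_right hxy.le, max_eq_right (by omega), max_eq_right (by omega)]
    ring
  · rw [if_pos rfl, max_self, max_eq_left (by omega), max_eq_right (by omega), walkRes_succ hx]
    field_simp
    ring
  · obtain ⟨x, rfl⟩ : ∃ z, x = z + 1 := ⟨x - 1, by omega⟩
    have hq := (h.q_pos x hx).ne'
    have hW' := (h.walkWeight_pos (by omega : x < N)).ne'
    have hp' := (h.p_pos x (by omega)).ne'
    rw [if_neg hxy.ne', max_eq_left hxy.le, max_eq_left (by omega), max_eq_left (by omega),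
      Nat.add_sub_cancel, walkRes_succ hx, walkRes_succ (by omega : x < N), walkRes_succ hx]
    have : walkWeight p q (x + 1) = walkWeight p q x * p x / q (x + 1) := rfl
    rw [this]
    field_simp
    ring

lemma walkGreen_eq (h : IsKilledWalk N p q) {d : ℕ → ℝ} (hd : ∀ x, N ≤ x → d x = 0) :
    walkGreen N p q d = d + killedStep N p q (walkGreen N p q d) := by
  ext x
  rw [Pi.add_apply, killedStep_apply]
  split_ifs with hx
  · have key : p x * (walkGreen N p q d x - walkGreen N p q d (x + 1)) +
        q x * (walkGreen N p q d x - walkGreen N p q d (x - 1)) = d x := by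
      unfold walkGreen
      rw [← Finset.sum_sub_distrib, ← Finset.sum_sub_distrib, Finset.mul_sum, Finset.mul_sum,
        ← Finset.sum_add_distrib]
      calc _ = ∑ y ∈ Finset.range N, d y * (if x = y then 1 else 0) :=
            Finset.sum_congr rfl fun y hy => by
              rw [← h.walkRes_max_sub hx (Finset.mem_range.1 hy)]
              ring
        _ = d x := by simp [hx]
    linarith
  · rw [walkGreen_eq_zero d (not_lt.1 hx), hd x (not_lt.1 hx), add_zero]

lemma sum_killedStep_pow {b d : ℕ → ℝ} (hb : b = d + killedStep N p q b) (m x : ℕ) :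
    ∑ k ∈ Finset.range m, (killedStep N p q ^ k) d x = b x - (killedStep N p q ^ m) b x := by
  induction m with
  | zero => simp
  | succ m ih =>
    have hd : d = b - killedStep N p q b := by rw [eq_sub_iff_add_eq]; exact hb.symm
    rw [Finset.sum_range_succ, ih, killedStep_pow_succ']
    conv_lhs => rw [hd, map_sub]
    simp only [Pi.sub_apply]
    ring

lemma sum_succ_mul_killedStep_pow {b d e : ℕ → ℝ} (hb : b = d + killedStep N p q b)
    (he : e = b + killedStep N p q e) (m x : ℕ) :
    ∑ k ∈ Finset.range m, ((k : ℝ) + 1) * (killedStep N p q ^ k) d x =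
      e x - (killedStep N p q ^ m) e x - m * (killedStep N p q ^ m) b x := by
  induction m with
  | zero => simp
  | succ m ih =>
    have hd : d = b - killedStep N p q b := by rw [eq_sub_iff_add_eq]; exact hb.symm
    have h1 : (killedStep N p q ^ m) d x =
        (killedStep N p q ^ m) b x - (killedStep N p q ^ (m + 1)) b x := by
      conv_lhs => rw [hd, map_sub]
      rw [killedStep_pow_succ', Pi.sub_apply]
    have h2 : (killedStep N p q ^ m) e x =
        (killedStep N p q ^ m) b x + (killedStep N p q ^ (m + 1)) e x := by
      conv_lhs => rw [he, map_add]
      rw [killedStep_pow_succ', Pi.add_apply]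
    rw [Finset.sum_range_succ, ih, h1, h2]
    push_cast
    ring

lemma exists_abs_le_mul_indBelow {b : ℕ → ℝ} (hb : ∀ x, N ≤ x → b x = 0) :
    ∃ C, 0 ≤ C ∧ ∀ x, |b x| ≤ C * indBelow N x := by
  refine ⟨∑ y ∈ Finset.range N, |b y|, Finset.sum_nonneg fun _ _ => abs_nonneg _, fun x => ?_⟩
  unfold indBelow
  split_ifs with hx
  · rw [mul_one]
    exact Finset.single_le_sum (f := fun y => |b y|) (fun _ _ => abs_nonneg _)
      (Finset.mem_range.2 hx)
  · simp [hb x (not_lt.1 hx)]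

lemma killedStep_pow_le (h : IsKilledWalk N p q) {b : ℕ → ℝ} {C : ℝ}
    (hC : ∀ x, b x ≤ C * indBelow N x) (m x : ℕ) :
    (killedStep N p q ^ m) b x ≤ C * walkSurv N p q m x := by
  have h1 := h.killedStep_pow_mono (g := C • indBelow N) hC m x
  rwa [map_smul] at h1

lemma walkGreen_indBelow_eq (h : IsKilledWalk N p q) :
    walkGreen N p q (indBelow N) =
      indBelow N + killedStep N p q (walkGreen N p q (indBelow N)) :=
  h.walkGreen_eq fun _ hx => if_neg (not_lt.2 hx)

lemma summable_walkSurv (h : IsKilledWalk N p q) (x : ℕ) :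
    Summable fun m => walkSurv N p q m x := by
  refine summable_of_sum_range_le (c := walkGreen N p q (indBelow N) x)
    (fun m => h.walkSurv_nonneg m x) fun m => ?_
  have h1 := h.killedStep_pow_nonneg (h.walkGreen_nonneg (indBelow_nonneg N)) m x
  have h2 := sum_killedStep_pow h.walkGreen_indBelow_eq m x
  simp only [walkSurv]
  linarith

lemma tendsto_killedStep_pow (h : IsKilledWalk N p q) {b : ℕ → ℝ} (hb0 : ∀ x, 0 ≤ b x)
    (hb : ∀ x, N ≤ x → b x = 0) (x : ℕ) :
    Tendsto (fun m => (killedStep N p q ^ m) b x) atTop (nhds 0) := by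
  obtain ⟨C, -, hC⟩ := exists_abs_le_mul_indBelow hb
  have h1 := (h.summable_walkSurv x).tendsto_atTop_zero.const_mul C
  rw [mul_zero] at h1
  exact squeeze_zero (fun m => h.killedStep_pow_nonneg hb0 m x)
    (fun m => h.killedStep_pow_le (fun y => (le_abs_self _).trans (hC y)) m x) h1

/-- The mean exit time of the killed walk. -/
lemma hasSum_walkSurv (h : IsKilledWalk N p q) (x : ℕ) :
    HasSum (fun m => walkSurv N p q m x) (walkGreen N p q (indBelow N) x) := by
  rw [hasSum_iff_tendsto_nat_of_nonneg fun m => h.walkSurv_nonneg m x]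
  have h1 := (h.tendsto_killedStep_pow (h.walkGreen_nonneg (indBelow_nonneg N))
    (fun _ => walkGreen_eq_zero _) x).const_sub (walkGreen N p q (indBelow N) x)
  rw [sub_zero] at h1
  exact h1.congr fun m => (sum_killedStep_pow h.walkGreen_indBelow_eq m x).symm

/-- Half the second moment of the continuous-time exit time of the killed walk. -/
lemma hasSum_succ_mul_walkSurv (h : IsKilledWalk N p q) (x : ℕ) :
    HasSum (fun m : ℕ => ((m : ℝ) + 1) * walkSurv N p q m x)
      (walkGreen N p q (walkGreen N p q (indBelow N)) x) := by
  set f := walkGreen N p q (indBelow N) with hf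
  have hf0 : ∀ x, 0 ≤ f x := h.walkGreen_nonneg (indBelow_nonneg N)
  have hfN : ∀ x, N ≤ x → f x = 0 := fun _ => walkGreen_eq_zero _
  have hF := h.walkGreen_eq hfN
  have hF0 := h.walkGreen_nonneg hf0
  have hsum := sum_succ_mul_killedStep_pow h.walkGreen_indBelow_eq hF (x := x)
  have hnn : ∀ m : ℕ, 0 ≤ ((m : ℝ) + 1) * walkSurv N p q m x := fun m =>
    mul_nonneg (by positivity) (h.walkSurv_nonneg m x)
  have hsm : Summable fun m : ℕ => ((m : ℝ) + 1) * walkSurv N p q m x := by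
    refine summable_of_sum_range_le (c := walkGreen N p q f x) hnn fun m => ?_
    have h1 := h.killedStep_pow_nonneg hF0 m x
    have h2 := mul_nonneg (Nat.cast_nonneg (α := ℝ) m) (h.killedStep_pow_nonneg hf0 m x)
    have h3 := hsum m
    simp only [walkSurv]
    linarith
  obtain ⟨C, hC0, hC⟩ := exists_abs_le_mul_indBelow hfN
  have h1 : Tendsto (fun m : ℕ => (m : ℝ) * (killedStep N p q ^ m) f x) atTop (nhds 0) := by
    have h2 := hsm.tendsto_atTop_zero.const_mul C
    rw [mul_zero] at h2
    refine squeeze_zero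
      (fun m => mul_nonneg (Nat.cast_nonneg m) (h.killedStep_pow_nonneg hf0 m x)) (fun m => ?_) h2
    have h3 := mul_le_mul_of_nonneg_left
      (h.killedStep_pow_le (fun y => (le_abs_self _).trans (hC y)) m x) (Nat.cast_nonneg (α := ℝ) m)
    have h4 := mul_nonneg hC0 (h.walkSurv_nonneg m x)
    linarith
  rw [hasSum_iff_tendsto_nat_of_nonneg hnn]
  have h2 := ((h.tendsto_killedStep_pow hF0 (fun _ => walkGreen_eq_zero _) x).const_sub
    (walkGreen N p q f x)).sub h1
  rw [sub_zero, sub_zero] at h2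
  exact h2.congr fun m => (hsum m).symm

lemma walkGreen_indBelow_zero :
    walkGreen N p q (indBelow N) 0 =
      ∑ y ∈ Finset.range N, walkWeight p q y * walkRes N p q y :=
  Finset.sum_congr rfl fun y hy => by
    rw [indBelow, if_pos (Finset.mem_range.1 hy), mul_one, Nat.zero_max]

/-- The variance of the exit time from `0` is the trace of the square of the Green operator. -/
lemma two_mul_walkGreen_sub_sq :
    2 * walkGreen N p q (walkGreen N p q (indBelow N)) 0 - walkGreen N p q (indBelow N) 0 ^ 2 =
      ∑ y ∈ Finset.range N, ∑ z ∈ Finset.range N,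
        walkWeight p q y * walkWeight p q z * walkRes N p q (max y z) ^ 2 := by
  set W := walkWeight p q
  set g := walkRes N p q
  have h1 : walkGreen N p q (walkGreen N p q (indBelow N)) 0 =
      ∑ y ∈ Finset.range N, ∑ z ∈ Finset.range N, W y * W z * (g y * g (max y z)) := by
    refine Finset.sum_congr rfl fun y _ => ?_
    rw [walkGreen, Finset.mul_sum, Finset.sum_mul]
    refine Finset.sum_congr rfl fun z hz => ?_
    rw [indBelow, if_pos (Finset.mem_range.1 hz), Nat.zero_max]
    ring
  have h2 : walkGreen N p q (walkGreen N p q (indBelow N)) 0 =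
      ∑ y ∈ Finset.range N, ∑ z ∈ Finset.range N, W y * W z * (g z * g (max y z)) := by
    rw [h1, Finset.sum_comm]
    refine Finset.sum_congr rfl fun y _ => Finset.sum_congr rfl fun z _ => ?_
    rw [max_comm]
    ring
  rw [two_mul]
  nth_rewrite 1 [h1]
  rw [h2, walkGreen_indBelow_zero, sq, Finset.sum_mul_sum, ← Finset.sum_add_distrib,
    ← Finset.sum_sub_distrib]
  refine Finset.sum_congr rfl fun y _ => ?_
  rw [← Finset.sum_add_distrib, ← Finset.sum_sub_distrib]
  refine Finset.sum_congr rfl fun z _ => ?_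
  rcases le_total y z with hyz | hyz
  · rw [max_eq_right hyz]; ring
  · rw [max_eq_left hyz]; ring

end IsKilledWalk

namespace Matrix

lemma IsHermitian.trace_mul_self_eq_sum {ι : Type*} [Fintype ι] [DecidableEq ι]
    {A : Matrix ι ι ℝ} (hA : A.IsHermitian) :
    (A * A).trace = ∑ j, hA.eigenvalues j ^ 2 := by
  conv_lhs => rw [hA.spectral_theorem, ← map_mul, Unitary.conjStarAlgAut_apply, trace_mul_comm,
    ← mul_assoc, Unitary.coe_star_mul_self, one_mul, diagonal_mul_diagonal, trace_diagonal]
  simp [sq]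

/-- A positive semidefinite matrix has an eigenvalue `θ` with `tr A² ≤ θ tr A`. -/
lemma PosSemidef.exists_eigenvalue_trace_le {ι : Type*} [Fintype ι] [DecidableEq ι]
    {A : Matrix ι ι ℝ} (hA : A.PosSemidef) (htr : 0 < A.trace) :
    ∃ θ : ℝ, 0 < θ ∧ (A * A).trace ≤ θ * A.trace ∧ ∃ v : ι → ℝ, v ≠ 0 ∧ A *ᵥ v = θ • v := by
  have hne : Nonempty ι := by
    by_contra hcon
    rw [not_nonempty_iff] at hcon
    simp [trace] at htr
  have htrace : A.trace = ∑ j, hA.1.eigenvalues j := by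
    simpa using hA.1.trace_eq_sum_eigenvalues
  obtain ⟨j, hj⟩ := Finite.exists_max hA.1.eigenvalues
  refine ⟨hA.1.eigenvalues j, ?_, ?_, ⇑(hA.1.eigenvectorBasis j), ?_,
    hA.1.mulVec_eigenvectorBasis j⟩
  · by_contra! hcon
    exact htr.not_ge (htrace.trans_le (Finset.sum_nonpos fun k _ => (hj k).trans hcon))
  · rw [hA.1.trace_mul_self_eq_sum, htrace, Finset.mul_sum]
    refine Finset.sum_le_sum fun k _ => ?_
    rw [sq]
    exact mul_le_mul_of_nonneg_right (hj k) (hA.eigenvalues_nonneg k)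
  · intro h0
    refine hA.1.eigenvectorBasis.orthonormal.ne_zero j ?_
    ext k
    exact congrFun h0 k

end Matrix

namespace IsKilledWalk

variable {N : ℕ} {p q : ℕ → ℝ}

lemma walkGreen_indBelow_zero_pos (h : IsKilledWalk N p q) (hN : 0 < N) :
    0 < walkGreen N p q (indBelow N) 0 := by
  rw [walkGreen_indBelow_zero]
  exact Finset.sum_pos (fun y hy => mul_pos (h.walkWeight_pos (Finset.mem_range.1 hy))
    (h.walkRes_pos (Finset.mem_range.1 hy))) (Finset.nonempty_range_iff.2 hN.ne')

lemma two_mul_walkGreen_sub_sq_nonneg (h : IsKilledWalk N p q) :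
    0 ≤ 2 * walkGreen N p q (walkGreen N p q (indBelow N)) 0 -
      walkGreen N p q (indBelow N) 0 ^ 2 := by
  rw [two_mul_walkGreen_sub_sq]
  exact Finset.sum_nonneg fun y hy => Finset.sum_nonneg fun z hz => mul_nonneg
    (mul_pos (h.walkWeight_pos (Finset.mem_range.1 hy))
      (h.walkWeight_pos (Finset.mem_range.1 hz))).le (sq_nonneg _)

/-- The Green operator has an eigenvalue `θ` dominating the ratio of the variance to the mean of
the exit time from `0`. -/
lemma exists_walkGreen_eigenvalue (h : IsKilledWalk N p q) (hN : 0 < N) :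
    ∃ θ : ℝ, 0 < θ ∧
      2 * walkGreen N p q (walkGreen N p q (indBelow N)) 0 - walkGreen N p q (indBelow N) 0 ^ 2 ≤
        θ * walkGreen N p q (indBelow N) 0 ∧
      ∃ φ : ℕ → ℝ, φ ≠ 0 ∧ (∀ x, N ≤ x → φ x = 0) ∧ walkGreen N p q φ = θ • φ := by
  set W := walkWeight p q with hWdef
  have hW : ∀ x : Fin N, 0 < W x := fun x => h.walkWeight_pos x.2
  set B : Matrix (Fin N) (Fin N) ℝ := Matrix.of fun z x =>
    if x ≤ z then √(W x) * √((W z * p z)⁻¹) else 0 with hB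
  set A : Matrix (Fin N) (Fin N) ℝ := Bᴴ * B with hAdef
  have hA : ∀ x y : Fin N, A x y = √(W x) * √(W y) * walkRes N p q (max x y) := by
    intro x y
    have h1 : walkRes N p q (max x y) =
        ∑ z : Fin N, if x ≤ z ∧ y ≤ z then (W z * p z)⁻¹ else 0 := by
      have h2 := Finset.sum_range (n := N)
        fun z => if (x : ℕ) ≤ z ∧ (y : ℕ) ≤ z then (W z * p z)⁻¹ else 0
      simp only [Fin.le_def]
      rw [← h2, ← Finset.sum_filter, walkRes]
      congr 1
      ext z
      simp only [Finset.mem_Ico, Finset.mem_filter, Finset.mem_range]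
      omega
    rw [h1, hAdef, Matrix.mul_apply, Finset.mul_sum]
    refine Finset.sum_congr rfl fun z _ => ?_
    have hz : 0 ≤ (W z * p z)⁻¹ := (inv_pos.2 (mul_pos (hW z) (h.p_pos z z.2))).le
    simp only [hB, Matrix.conjTranspose_apply, Matrix.of_apply, star_trivial]
    by_cases hx : x ≤ z <;> by_cases hy : y ≤ z <;> simp only [hx, hy, if_true, if_false,
      and_self, and_true, and_false, mul_zero, zero_mul]
    rw [mul_mul_mul_comm, Real.mul_self_sqrt hz]
  have hps : A.PosSemidef := Matrix.posSemidef_conjTranspose_mul_self B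
  have htr : A.trace = walkGreen N p q (indBelow N) 0 := by
    rw [walkGreen_indBelow_zero, Finset.sum_range, Matrix.trace]
    refine Finset.sum_congr rfl fun x _ => ?_
    rw [Matrix.diag_apply, hA, max_self, Real.mul_self_sqrt (hW x).le]
  have htr2 : (A * A).trace = 2 * walkGreen N p q (walkGreen N p q (indBelow N)) 0 -
      walkGreen N p q (indBelow N) 0 ^ 2 := by
    rw [two_mul_walkGreen_sub_sq, Finset.sum_range, Matrix.trace]
    refine Finset.sum_congr rfl fun x _ => ?_
    rw [Finset.sum_range, Matrix.diag_apply, Matrix.mul_apply]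
    refine Finset.sum_congr rfl fun y _ => ?_
    rw [hA, hA, max_comm (y : ℕ)]
    calc _ = (√(W x) * √(W x)) * (√(W y) * √(W y)) * walkRes N p q (max x y) ^ 2 := by ring
      _ = _ := by rw [Real.mul_self_sqrt (hW x).le, Real.mul_self_sqrt (hW y).le]
  have hpos : 0 < A.trace := htr ▸ h.walkGreen_indBelow_zero_pos hN
  obtain ⟨θ, hθ, hle, v, hv0, hv⟩ := hps.exists_eigenvalue_trace_le hpos
  rw [htr2, htr] at hle
  refine ⟨θ, hθ, hle, fun x => if hx : x < N then v ⟨x, hx⟩ / √(W x) else 0, ?_, ?_, ?_⟩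
  · intro h0
    refine hv0 (funext fun x => ?_)
    have h1 := congrFun h0 x
    simpa [x.2, (Real.sqrt_pos.2 (hW x)).ne'] using h1
  · intro x hx
    exact dif_neg (not_lt.2 hx)
  · ext x
    by_cases hx : x < N
    · have h1 := congrFun hv ⟨x, hx⟩
      have hs := (Real.sqrt_pos.2 (hW ⟨x, hx⟩)).ne'
      simp only [Matrix.mulVec, dotProduct, hA, Pi.smul_apply, smul_eq_mul] at h1
      simp only [Pi.smul_apply, smul_eq_mul, dif_pos hx]
      rw [← mul_div_assoc, ← h1, eq_div_iff hs, walkGreen, Finset.sum_range, Finset.sum_mul]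
      refine Finset.sum_congr rfl fun y _ => ?_
      have hy := (Real.sqrt_pos.2 (hW y)).ne'
      rw [dif_pos y.2]
      have h2 : walkWeight p q y = √(W y) * √(W y) := (Real.mul_self_sqrt (hW y).le).symm
      rw [h2]
      field_simp
    · simp [walkGreen_eq_zero _ (not_lt.1 hx), hx]

/-- Eigenvectors of the Green operator give geometric lower bounds on survival. -/
lemma pow_le_walkSurv (h : IsKilledWalk N p q) {θ : ℝ} (hθ : 0 < θ) {φ : ℕ → ℝ}
    (hφ : φ ≠ 0) (hφN : ∀ x, N ≤ x → φ x = 0) (heig : walkGreen N p q φ = θ • φ)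
    (m : ℕ) : (1 - θ⁻¹) ^ m ≤ walkSurv N p q m 0 := by
  have hstep : killedStep N p q φ = (1 - θ⁻¹) • φ := by
    have h1 := h.walkGreen_eq hφN
    rw [heig, map_smul] at h1
    ext x
    have h2 := congrFun h1 x
    simp only [Pi.add_apply, Pi.smul_apply, smul_eq_mul] at h2 ⊢
    field_simp
    linarith
  have hpow : (killedStep N p q ^ m) φ = (1 - θ⁻¹) ^ m • φ := by
    induction m with
    | zero => simp
    | succ m ih => rw [killedStep_pow_succ, ih, map_smul, hstep, smul_smul, pow_succ]
  obtain ⟨z, hz⟩ := Function.ne_iff.1 hφ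
  have hzN : z < N := not_le.1 fun hcon => hz (hφN z hcon)
  obtain ⟨x, hx, hmax⟩ := Finset.exists_max_image (Finset.range N) (fun y => |φ y|)
    ⟨z, Finset.mem_range.2 hzN⟩
  have hpos : 0 < |φ x| := (abs_pos.2 hz).trans_le (hmax z (Finset.mem_range.2 hzN))
  have hbd : ∀ y, |φ y| ≤ |φ x| * indBelow N y := by
    intro y
    unfold indBelow
    split_ifs with hy
    · rw [mul_one]
      exact hmax y (Finset.mem_range.2 hy)
    · simp [hφN y (not_lt.1 hy)]
  have hle1 := h.killedStep_pow_le (fun y => (le_abs_self _).trans (hbd y)) m x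
  have hle2 := h.killedStep_pow_le (b := -φ) (fun y => (neg_le_abs _).trans (hbd y)) m x
  rw [map_neg] at hle2
  rw [hpow] at hle1 hle2
  have h3 : |(1 - θ⁻¹) ^ m * φ x| ≤ |φ x| * walkSurv N p q m x :=
    abs_le'.2 ⟨hle1, hle2⟩
  rw [abs_mul, mul_comm, mul_le_mul_iff_right₀ hpos] at h3
  exact (le_abs_self _).trans (h3.trans (h.walkSurv_antitone_start m (Nat.zero_le x)))

end IsKilledWalk

/-- The mixture of a sequence by the Poisson distribution of mean `t`. -/
def poissonMix (w : ℕ → ℝ) (t : ℝ) : ℝ :=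
  ∑' m : ℕ, (Real.exp (-t) * t ^ m / m.factorial) * w m

lemma hasSum_pow_div_factorial (x : ℝ) :
    HasSum (fun m : ℕ => x ^ m / m.factorial) (Real.exp x) := by
  rw [Real.exp_eq_exp_ℝ]
  exact NormedSpace.expSeries_div_hasSum_exp x

lemma hasSum_poissonMix_pow (ρ t : ℝ) :
    HasSum (fun m : ℕ => (Real.exp (-t) * t ^ m / m.factorial) * ρ ^ m)
      (Real.exp (-t * (1 - ρ))) := by
  have h := (hasSum_pow_div_factorial (t * ρ)).mul_left (Real.exp (-t))
  rw [← Real.exp_add, show -t + t * ρ = -t * (1 - ρ) by ring] at h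
  exact h.congr_fun fun m => by rw [mul_pow]; ring

section PoissonMix

variable {w : ℕ → ℝ} {t : ℝ}

lemma summable_poissonMix (hw0 : ∀ m, 0 ≤ w m) (hw1 : ∀ m, w m ≤ 1) (ht : 0 ≤ t) :
    Summable fun m : ℕ => (Real.exp (-t) * t ^ m / m.factorial) * w m := by
  refine Summable.of_nonneg_of_le (fun m => mul_nonneg (by positivity) (hw0 m)) (fun m => ?_)
    (hasSum_poissonMix_pow 1 t).summable
  rw [one_pow]
  exact mul_le_mul_of_nonneg_left (hw1 m) (by positivity)

lemma poissonMix_nonneg (hw0 : ∀ m, 0 ≤ w m) (ht : 0 ≤ t) : 0 ≤ poissonMix w t :=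
  tsum_nonneg fun m => mul_nonneg (by positivity) (hw0 m)

lemma exp_le_poissonMix (hw0 : ∀ m, 0 ≤ w m) (hw1 : ∀ m, w m ≤ 1) (ht : 0 ≤ t) {ρ : ℝ}
    (hρ : ∀ m, ρ ^ m ≤ w m) : Real.exp (-t * (1 - ρ)) ≤ poissonMix w t :=
  hasSum_le (fun m => mul_le_mul_of_nonneg_left (hρ m) (by positivity))
    (hasSum_poissonMix_pow ρ t) (summable_poissonMix hw0 hw1 ht).hasSum

lemma poissonMix_le_one (hw0 : ∀ m, 0 ≤ w m) (hw1 : ∀ m, w m ≤ 1) (ht : 0 ≤ t) :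
    poissonMix w t ≤ 1 := by
  have h := hasSum_le (fun m => mul_le_mul_of_nonneg_left ((hw1 m).trans_eq (one_pow m).symm)
    (by positivity)) (summable_poissonMix hw0 hw1 ht).hasSum (hasSum_poissonMix_pow 1 t)
  rwa [sub_self, mul_zero, Real.exp_zero] at h

lemma poissonMix_antitoneOn (hw0 : ∀ m, 0 ≤ w m) (hw1 : ∀ m, w m ≤ 1) (hw : Antitone w) :
    AntitoneOn (poissonMix w) (Set.Ici 0) := by
  intro s hs t _ hst
  rw [Set.mem_Ici] at hs
  obtain ⟨u, rfl⟩ : ∃ u, t = s + u := ⟨t - s, by ring⟩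
  have hu : 0 ≤ u := by linarith
  have hf : Summable fun m : ℕ => (Real.exp (-s) * s ^ m / m.factorial) * w m :=
    summable_poissonMix hw0 hw1 hs
  have hg : HasSum (fun m : ℕ => (Real.exp (-u) * u ^ m / m.factorial)) 1 := by
    simpa using hasSum_poissonMix_pow 1 u
  have hconv := tsum_mul_tsum_eq_tsum_sum_antidiagonal_of_summable_norm hf.norm hg.summable.norm
  have hsummable := (summable_norm_sum_mul_antidiagonal_of_summable_norm
    hf.norm hg.summable.norm).of_norm
  rw [hg.tsum_eq, mul_one] at hconv
  unfold poissonMix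
  rw [hconv]
  refine (summable_poissonMix hw0 hw1 (add_nonneg hs hu)).tsum_le_tsum (fun m => ?_) hsummable
  have hbin : Real.exp (-(s + u)) * (s + u) ^ m / m.factorial =
      ∑ kl ∈ Finset.HasAntidiagonal.antidiagonal m, (Real.exp (-s) * s ^ kl.1 / kl.1.factorial) *
        (Real.exp (-u) * u ^ kl.2 / kl.2.factorial) := by
    rw [(Commute.all s u).add_pow', Finset.mul_sum, Finset.sum_div]
    refine Finset.sum_congr rfl fun kl hkl => ?_
    have hkl := Finset.HasAntidiagonal.mem_antidiagonal.1 hkl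
    have hc : (m.factorial : ℝ) = m.choose kl.1 * kl.1.factorial * kl.2.factorial := by
      rw [← hkl, ← Nat.add_choose_mul_factorial_mul_factorial, Nat.choose_symm_add]
      push_cast
      rfl
    have hch : (m.choose kl.1 : ℝ) ≠ 0 := by
      exact_mod_cast (Nat.choose_pos (by omega)).ne'
    have h1 : (kl.1.factorial : ℝ) ≠ 0 := by positivity
    have h2 : (kl.2.factorial : ℝ) ≠ 0 := by positivity
    rw [hc, nsmul_eq_mul, neg_add, Real.exp_add]
    field_simp
  rw [hbin, Finset.sum_mul]
  refine Finset.sum_le_sum fun kl hkl => ?_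
  have hkl := Finset.HasAntidiagonal.mem_antidiagonal.1 hkl
  have h1 : 0 ≤ (Real.exp (-s) * s ^ kl.1 / kl.1.factorial) *
      (Real.exp (-u) * u ^ kl.2 / kl.2.factorial) := by positivity
  have h2 := mul_le_mul_of_nonneg_left (hw (by omega : kl.1 ≤ m)) h1
  linarith

lemma integral_pow_mul_exp_neg (k : ℕ) :
    ∫ t in Set.Ioi (0 : ℝ), t ^ k * Real.exp (-t) = k.factorial := by
  rw [← Real.Gamma_nat_eq_factorial, Real.Gamma_eq_integral (by positivity)]
  refine setIntegral_congr_fun measurableSet_Ioi fun t _ => ?_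
  simp only [add_sub_cancel_right, Real.rpow_natCast]
  ring

lemma integrableOn_pow_mul_exp_neg (k : ℕ) :
    IntegrableOn (fun t : ℝ => t ^ k * Real.exp (-t)) (Set.Ioi 0) :=
  Integrable.of_integral_ne_zero (by rw [integral_pow_mul_exp_neg]; positivity)

lemma hasSum_integral_poissonMix (k : ℕ) (hw0 : ∀ m, 0 ≤ w m) {A : ℝ}
    (hA : HasSum (fun m : ℕ => ((m + k).factorial : ℝ) / m.factorial * w m) A) :
    ∫ t in Set.Ioi (0 : ℝ), t ^ k * poissonMix w t = A := by
  set F : ℕ → ℝ → ℝ := fun m t => (w m / m.factorial) * (t ^ (m + k) * Real.exp (-t)) with hF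
  have hint : ∀ m, IntegrableOn (F m) (Set.Ioi 0) := fun m =>
    (integrableOn_pow_mul_exp_neg (m + k)).const_mul _
  have hval : ∀ m, ∫ t in Set.Ioi (0 : ℝ), F m t = ((m + k).factorial : ℝ) / m.factorial * w m := by
    intro m
    rw [hF, integral_const_mul, integral_pow_mul_exp_neg]
    ring
  have hnorm : ∀ m, ∫ t in Set.Ioi (0 : ℝ), ‖F m t‖ = ∫ t in Set.Ioi (0 : ℝ), F m t := fun m =>
    setIntegral_congr_fun measurableSet_Ioi fun t ht => Real.norm_of_nonneg <| by
      have ht' : (0 : ℝ) < t := ht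
      have := hw0 m
      positivity
  have hsum := hasSum_integral_of_summable_integral_norm hint
    (by simpa only [hnorm, hval] using hA.summable)
  simp only [hval] at hsum
  rw [← hsum.unique hA]
  refine setIntegral_congr_fun measurableSet_Ioi fun t _ => ?_
  simp only [poissonMix, hF]
  rw [← tsum_mul_left]
  refine tsum_congr fun m => ?_
  rw [pow_add]
  ring

end PoissonMix

/-- Cantelli's inequality for the survival function `S` of a nonnegative random variable. -/
lemma cantelli_survival {S : ℝ → ℝ} {μ M s : ℝ} (hS : AntitoneOn S (Set.Ici 0))
    (hS0 : ∀ t, 0 ≤ t → 0 ≤ S t) (hS1 : ∀ t, 0 ≤ t → S t ≤ 1)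
    (hint : IntegrableOn S (Set.Ioi 0)) (hint' : IntegrableOn (fun t => t * S t) (Set.Ioi 0))
    (hμ : ∫ t in Set.Ioi (0 : ℝ), S t = μ) (hM : ∫ t in Set.Ioi (0 : ℝ), t * S t = M)
    (hs : 0 ≤ s) (hsμ : s < μ) (hV : 0 ≤ 2 * M - μ ^ 2) :
    (μ - s) ^ 2 / ((2 * M - μ ^ 2) + (μ - s) ^ 2) ≤ S s := by
  have key : ∀ d, s ≤ d → (1 - S s) * (d - s) ^ 2 ≤ 2 * M - μ ^ 2 + (d - μ) ^ 2 := by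
    intro d hsd
    have hd : 0 ≤ d := hs.trans hsd
    have hprim : ∀ r, 0 ≤ r → ∫ t in Set.Ioi (0 : ℝ),
        (Set.Ioc 0 r).indicator (fun t => 2 * (t - d)) t = r ^ 2 - 2 * d * r := by
      intro r hr
      rw [setIntegral_indicator measurableSet_Ioc,
        Set.inter_eq_right.2 fun t ht => Set.mem_Ioi.2 ht.1,
        ← intervalIntegral.integral_of_le hr, intervalIntegral.integral_const_mul,
        intervalIntegral.integral_sub (by simp) (by simp)]
      simp
      ring
    have hind : ∀ r, IntegrableOn ((Set.Ioc 0 r).indicator fun t => 2 * (t - d))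
        (Set.Ioi 0) := fun r =>
      (IntegrableOn.integrable_indicator ((by fun_prop : Continuous fun t : ℝ =>
        2 * (t - d)).integrableOn_Ioc) measurableSet_Ioc).integrableOn
    have hmono := setIntegral_mono_on (μ := volume)
      (((hind d).const_mul (S s)).add ((hind s).const_mul (1 - S s)))
      ((hint'.const_mul 2).sub (hint.const_mul (2 * d))) measurableSet_Ioi fun t ht => by
        have ht0 : (0 : ℝ) < t := ht
        have h0 := hS0 t ht0.le
        have h1 := hS1 t ht0.le
        simp only [Pi.add_apply, Pi.sub_apply, Set.indicator_apply, Set.mem_Ioc, ht0, true_and]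
        rcases le_or_gt t s with hts | hts
        · rw [if_pos (hts.trans hsd), if_pos hts]
          nlinarith
        · have h2 := hS hs (Set.mem_Ici.2 ht0.le) hts.le
          rw [if_neg hts.not_ge]
          split_ifs with htd
          · nlinarith
          · nlinarith
    simp only [Pi.add_apply, Pi.sub_apply] at hmono
    rw [integral_add ((hind d).const_mul (S s)) ((hind s).const_mul (1 - S s)),
      integral_sub (hint'.const_mul 2) (hint.const_mul (2 * d)), integral_const_mul,
      integral_const_mul, integral_const_mul, integral_const_mul, hprim d hd, hprim s hs, hμ,
      hM] at hmono
    nlinarith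
  set V := 2 * M - μ ^ 2
  have hδ : 0 < μ - s := by linarith
  have h1 := key (μ + V / (μ - s)) (by have := div_nonneg hV hδ.le; linarith)
  have h2 : (1 - S s) * (V + (μ - s) ^ 2) ≤ V := by
    have h3 : (1 - S s) * (μ + V / (μ - s) - s) ^ 2 * (μ - s) ^ 2 =
        (1 - S s) * (V + (μ - s) ^ 2) * (V + (μ - s) ^ 2) := by
      field_simp
      ring
    have h4 : (V + (μ + V / (μ - s) - μ) ^ 2) * (μ - s) ^ 2 = V * (V + (μ - s) ^ 2) := by
      field_simp
      ring
    have h5 := mul_le_mul_of_nonneg_right h1 (sq_nonneg (μ - s))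
    rw [h3, h4] at h5
    exact le_of_mul_le_mul_right h5 (by positivity)
  rw [div_le_iff₀ (by positivity)]
  linarith

namespace BDChain

variable {n : ℕ}

/-- The probability of a step up from `x`. -/
def up (c : BDChain n) (x : ℕ) : ℝ :=
  if h : x < n then c.K ⟨x, by omega⟩ ⟨x + 1, by omega⟩ else 0

/-- The probability of a step down from `x`. -/
def down (c : BDChain n) (x : ℕ) : ℝ :=
  if h : 0 < x ∧ x ≤ n then c.K ⟨x, by omega⟩ ⟨x - 1, by omega⟩ else 0

lemma sum_K_mul (c : BDChain n) (j : Fin (n + 1)) (hj : (j : ℕ) < n) (f : ℕ → ℝ) :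
    ∑ y, c.K j y * f y =
      (1 - c.up j - c.down j) * f j + c.up j * f (j + 1) + c.down j * f (j - 1) := by
  have hterm : ∀ y : Fin (n + 1), c.K j y * (f y - f j) =
      (if (⟨j + 1, by omega⟩ : Fin (n + 1)) = y then c.up j * (f (j + 1) - f j) else 0) +
      (if (⟨j - 1, by omega⟩ : Fin (n + 1)) = y then c.down j * (f (j - 1) - f j) else 0) := by
    intro y
    simp only [Fin.ext_iff]
    by_cases h1 : (j : ℕ) + 1 = y
    · have hy : y = ⟨j + 1, by omega⟩ := Fin.ext h1.symm
      rw [if_pos h1, if_neg (by omega), add_zero, up, dif_pos hj, hy]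
    · rw [if_neg h1, zero_add]
      by_cases h2 : (j : ℕ) - 1 = y
      · have hy : y = ⟨j - 1, by omega⟩ := Fin.ext h2.symm
        rw [if_pos h2]
        by_cases h0 : 0 < (j : ℕ)
        · rw [down, dif_pos ⟨h0, hj.le⟩, hy]
        · have h3 : (j : ℕ) - 1 = j := by omega
          rw [← h2, h3, sub_self, mul_zero, mul_zero]
      · rw [if_neg h2]
        by_cases h3 : y = j
        · rw [h3, sub_self, mul_zero]
        · rw [c.K_tridiag j y, zero_mul]
          rw [lt_abs]
          have : (y : ℕ) ≠ j := fun hcon => h3 (Fin.ext hcon)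
          omega
  have hsum : ∑ y, c.K j y * f y = ∑ y, c.K j y * (f y - f j) + f j := by
    simp only [mul_sub, Finset.sum_sub_distrib, ← Finset.sum_mul, c.K_rowSum]
    ring
  rw [hsum, Finset.sum_congr rfl fun y _ => hterm y, Finset.sum_add_distrib]
  simp only [Finset.sum_ite_eq, Finset.mem_univ, if_true]
  ring

lemma isKilledWalk (c : BDChain n) {N : ℕ} (hN : N ≤ n) : IsKilledWalk N c.up c.down where
  p_pos x hx := by
    rw [up, dif_pos (hx.trans_le hN)]
    exact (c.K_irred x (hx.trans_le hN)).1
  q_pos x hx := by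
    rw [down, dif_pos ⟨x.succ_pos, by omega⟩]
    exact (c.K_irred x (by omega)).2
  q_zero := by simp [down]
  add_le x hx := by
    have h1 := c.sum_K_mul ⟨x, by omega⟩ (hx.trans_le hN) (Pi.single x 1)
    have h2 : 0 ≤ ∑ y : Fin (n + 1), c.K ⟨x, by omega⟩ y * (Pi.single x 1 : ℕ → ℝ) y :=
      Finset.sum_nonneg fun y _ => mul_nonneg (c.K_nonneg _ _) (by
        rw [Pi.single_apply]
        split_ifs <;> norm_num)
    rw [h1] at h2
    rcases Nat.eq_zero_or_pos x with rfl | hx0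
    · simpa [down] using h2
    · simp only [Pi.single_apply, if_true] at h2
      rw [if_neg (by omega), if_neg (by omega)] at h2
      linarith

lemma hitSurv_zero_of_ne (c : BDChain n) {i j : Fin (n + 1)} (hj : j ≠ i) :
    c.hitSurv i j 0 = 1 := by
  simp [hitSurv, hj, Matrix.one_apply]

lemma hitSurv_succ_of_ne (c : BDChain n) {i j : Fin (n + 1)} (hj : j ≠ i) (m : ℕ) :
    c.hitSurv i j (m + 1) = ∑ y, c.K j y * c.hitSurv i y m := by
  rw [hitSurv, if_neg hj, pow_succ']
  simp only [Matrix.mul_apply]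
  rw [Finset.sum_comm]
  refine Finset.sum_congr rfl fun y _ => ?_
  rw [← Finset.mul_sum, hitSurv, killed, Matrix.of_apply]
  by_cases hy : y = i <;> simp [hj, hy]

lemma hitSurv_eq_walkSurv (c : BDChain n) (i : Fin (n + 1)) (m : ℕ) {j : Fin (n + 1)}
    (hj : j ≤ i) : c.hitSurv i j m = walkSurv i c.up c.down m j := by
  induction m generalizing j with
  | zero =>
    rw [walkSurv_zero, indBelow]
    rcases hj.eq_or_lt with rfl | hlt
    · simp [hitSurv]
    · rw [c.hitSurv_zero_of_ne hlt.ne, if_pos (Fin.lt_def.1 hlt)]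
  | succ m ih =>
    rw [walkSurv_succ, killedStep_apply]
    rcases hj.eq_or_lt with rfl | hlt
    · simp [hitSurv]
    · have hlt' : (j : ℕ) < i := hlt
      have h1 := c.sum_K_mul j (by omega)
        fun y => if h : y < n + 1 then c.hitSurv i ⟨y, h⟩ m else 0
      simp only [Fin.is_lt, dif_pos, Fin.eta] at h1
      rw [if_pos hlt', c.hitSurv_succ_of_ne hlt.ne, h1, dif_pos (by omega), dif_pos (by omega),
        ih hj, ih (j := ⟨j + 1, by omega⟩) (by rw [Fin.le_def]; exact hlt'),
        ih (j := ⟨j - 1, by omega⟩) (by rw [Fin.le_def]; dsimp only; omega)]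

lemma hitSurvC_zero_eq_poissonMix (c : BDChain n) (i : Fin (n + 1)) (t : ℝ) :
    c.hitSurvC i 0 t = poissonMix (fun m => walkSurv i c.up c.down m 0) t :=
  tsum_congr fun m => by rw [c.hitSurv_eq_walkSurv i m (Fin.zero_le i), Fin.val_zero]

end BDChain

/-- Lemma `l-hit1`.  For any irreducible birth and death chain on
`{0,…,n}`, any `0 < i ≤ n` and `a ∈ (0,1)`,
`P_0(τ̃_i > a·E_0 τ̃_i) ≥ min{e^{−√a}, (1−a)²/(√a + (1−a)²)}`. -/
theorem birth_death_hitting_time_lower_tail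
    {n : ℕ} (c : BDChain n) (i : Fin (n + 1)) (hi : i ≠ 0)
    (a : ℝ) (ha : a ∈ Set.Ioo (0 : ℝ) 1) :
    min (Real.exp (-Real.sqrt a)) ((1 - a) ^ 2 / (Real.sqrt a + (1 - a) ^ 2)) ≤
      c.hitSurvC i 0 (a * c.hitMeanC i 0) := by
  have hN : 0 < (i : ℕ) := Nat.pos_of_ne_zero fun h0 => hi (Fin.ext h0)
  have h := c.isKilledWalk (Nat.lt_succ_iff.1 i.2)
  set w : ℕ → ℝ := fun m => walkSurv i c.up c.down m 0 with hw
  have hw0 : ∀ m, 0 ≤ w m := fun m => h.walkSurv_nonneg m 0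
  have hw1 : ∀ m, w m ≤ 1 := fun m => h.walkSurv_le_one m 0
  have hS : ∀ t, c.hitSurvC i 0 t = poissonMix w t := c.hitSurvC_zero_eq_poissonMix i
  set μ := walkGreen i c.up c.down (indBelow i) 0
  set M := walkGreen i c.up c.down (walkGreen i c.up c.down (indBelow i)) 0
  obtain ⟨θ, hθ, hle, φ, hφ, hφN, heig⟩ := h.exists_walkGreen_eigenvalue hN
  have hμpos : 0 < μ := h.walkGreen_indBelow_zero_pos hN
  have hV : 0 ≤ 2 * M - μ ^ 2 := h.two_mul_walkGreen_sub_sq_nonneg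
  have hμ : ∫ t in Set.Ioi (0 : ℝ), poissonMix w t = μ := by
    have h1 := hasSum_integral_poissonMix 0 hw0 (A := μ) (by
      refine (h.hasSum_walkSurv 0).congr_fun fun m => ?_
      rw [add_zero, div_self (by positivity), one_mul])
    simpa using h1
  have hM : ∫ t in Set.Ioi (0 : ℝ), t * poissonMix w t = M := by
    have h1 := hasSum_integral_poissonMix 1 hw0 (A := M) (by
      refine (h.hasSum_succ_mul_walkSurv 0).congr_fun fun m => ?_
      rw [Nat.factorial_succ, Nat.cast_mul, mul_div_cancel_right₀ _ (by positivity)]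
      push_cast
      rfl)
    simpa using h1
  have hmean : c.hitMeanC i 0 = μ := by
    rw [← hμ]
    exact integral_congr_ae (Eventually.of_forall hS)
  obtain ⟨ha0, ha1⟩ := ha
  have hsa : 0 < √a := Real.sqrt_pos.2 ha0
  have hs : 0 ≤ a * μ := by positivity
  rw [hmean, hS]
  rcases le_total (√a * μ) θ with hcase | hcase
  · refine (min_le_left _ _).trans (le_trans ?_
      (exp_le_poissonMix hw0 hw1 hs (h.pow_le_walkSurv hθ hφ hφN heig)))
    rw [Real.exp_le_exp, sub_sub_cancel, neg_mul, neg_le_neg_iff, ← div_eq_mul_inv,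
      div_le_iff₀ hθ]
    calc a * μ = √a * (√a * μ) := by rw [← mul_assoc, Real.mul_self_sqrt ha0.le]
      _ ≤ √a * θ := mul_le_mul_of_nonneg_left hcase hsa.le
  · refine (min_le_right _ _).trans (le_trans ?_
      (cantelli_survival (poissonMix_antitoneOn hw0 hw1 (h.walkSurv_antitone 0))
        (fun t ht => poissonMix_nonneg hw0 ht) (fun t ht => poissonMix_le_one hw0 hw1 ht)
        (Integrable.of_integral_ne_zero (by rw [hμ]; exact hμpos.ne'))
        (Integrable.of_integral_ne_zero (by rw [hM]; nlinarith)) hμ hM hs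
        (by nlinarith) hV))
    have h1 : 2 * M - μ ^ 2 ≤ √a * μ ^ 2 := by
      nlinarith [mul_le_mul_of_nonneg_right hcase hμpos.le]
    have h2 : 0 < μ - a * μ := by nlinarith
    have h3 : 0 < (1 - a) ^ 2 := by nlinarith
    rw [div_le_div_iff₀ (by positivity) (by positivity)]
    nlinarith [mul_le_mul_of_nonneg_left h1 h3.le]

end
end

section
/- Let K be the transition matrix of an irreducible birth and death chain on {0,1,...,n} with transition rates p_i, q_i, r_i and stationary distribution π, and let τ_i and τ̃_i be the discrete- and continuous-time hitting times of state i. Then for all 0 ≤ i < j < k ≤ n, E_j min{τ_i, τ_k} = E_j min{τ̃_i, τ̃_k} = A/B, where A = Σ over pairs (ℓ_1, ℓ_2) with i+1 ≤ ℓ_1 ≤ j and j ≤ ℓ_2 ≤ k−1 of π([ℓ_1, ℓ_2]) / (π(ℓ_1)q_{ℓ_1}·π(ℓ_2)p_{ℓ_2}), and B = Σ_{ℓ=i}^{k−1} 1/(π(ℓ)p_ℓ). -/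
open scoped BigOperators
open Filter Matrix Polynomial MeasureTheory

noncomputable section

namespace BDChain

variable {n : ℕ}

lemma killed2_nonneg (c : BDChain n) (i k x y : Fin (n + 1)) : 0 ≤ c.killed2 i k x y := by
  simp only [killed2, Matrix.of_apply]
  split_ifs
  · exact le_rfl
  · exact c.K_nonneg x y

lemma hitSurv2_zero (c : BDChain n) {i k x : Fin (n + 1)} (hi : x ≠ i) (hk : x ≠ k) :
    c.hitSurv2 i k x 0 = 1 := by
  simp [hitSurv2, hi, hk, Matrix.one_apply]

lemma hitSurv2_succ (c : BDChain n) (i k x : Fin (n + 1)) (m : ℕ) :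
    c.hitSurv2 i k x (m + 1) = ∑ y, c.killed2 i k x y * c.hitSurv2 i k y m := by
  by_cases hx : x = i ∨ x = k
  · rw [hitSurv2, if_pos hx]
    refine (Finset.sum_eq_zero fun y _ => ?_).symm
    have : c.killed2 i k x y = 0 := by
      rw [killed2, Matrix.of_apply, if_pos (by tauto)]
    rw [this, zero_mul]
  · rw [hitSurv2, if_neg hx]
    simp only [pow_succ', Matrix.mul_apply]
    rw [Finset.sum_comm]
    refine Finset.sum_congr rfl fun y _ => ?_
    rw [← Finset.mul_sum]
    by_cases hy : y = i ∨ y = k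
    · have : c.killed2 i k x y = 0 := by
        rw [killed2, Matrix.of_apply, if_pos (by tauto)]
      rw [this, zero_mul, zero_mul]
    · rw [hitSurv2, if_neg hy]

lemma hitSurv2_nonneg (c : BDChain n) (i k x : Fin (n + 1)) (m : ℕ) :
    0 ≤ c.hitSurv2 i k x m := by
  induction m generalizing x with
  | zero =>
    by_cases hx : x = i ∨ x = k
    · rw [hitSurv2, if_pos hx]
    · rw [not_or] at hx
      rw [hitSurv2_zero c hx.1 hx.2]
      exact zero_le_one
  | succ m ih =>
    rw [hitSurv2_succ]
    exact Finset.sum_nonneg fun y _ => mul_nonneg (c.killed2_nonneg i k x y) (ih y)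

/-- From a state strictly between `i` and `k`, the killed chain stays strictly between them. -/
lemma killed2_eq_zero (c : BDChain n) {i k x y : Fin (n + 1)} (hix : i < x) (hxk : x < k)
    (hy : ¬(i < y ∧ y < k)) : c.killed2 i k x y = 0 := by
  rw [killed2, Matrix.of_apply]
  split_ifs with h
  · rfl
  · apply c.K_tridiag
    simp only [not_or, Fin.ext_iff] at h
    simp only [Fin.lt_def] at hix hxk hy
    rw [lt_abs]
    omega

lemma sum_killed2_mul_le (c : BDChain n) {i k x : Fin (n + 1)} (hix : i < x) (hxk : x < k)
    {f g : Fin (n + 1) → ℝ} (hfg : ∀ y, i < y → y < k → f y ≤ g y) :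
    ∑ y, c.killed2 i k x y * f y ≤ ∑ y, c.killed2 i k x y * g y := by
  refine Finset.sum_le_sum fun y _ => ?_
  by_cases hy : i < y ∧ y < k
  · exact mul_le_mul_of_nonneg_left (hfg y hy.1 hy.2) (c.killed2_nonneg i k x y)
  · rw [c.killed2_eq_zero hix hxk hy, zero_mul, zero_mul]

lemma sum_killed2_mul_eq (c : BDChain n) {i k x : Fin (n + 1)} (hix : i < x) (hxk : x < k)
    {h : Fin (n + 1) → ℝ} (hi : h i = 0) (hk : h k = 0) :
    ∑ y, c.killed2 i k x y * h y = ∑ y, c.K x y * h y := by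
  refine Finset.sum_congr rfl fun y _ => ?_
  by_cases hyi : y = i
  · rw [hyi, hi, mul_zero, mul_zero]
  by_cases hyk : y = k
  · rw [hyk, hk, mul_zero, mul_zero]
  rw [killed2, Matrix.of_apply, if_neg]
  simp [hyi, hyk, hix.ne', hxk.ne]

lemma sum_range_succ_hitSurv2 (c : BDChain n) {i k x : Fin (n + 1)} (hix : i < x) (hxk : x < k)
    (M : ℕ) :
    ∑ m ∈ Finset.range (M + 1), c.hitSurv2 i k x m =
      1 + ∑ y, c.killed2 i k x y * ∑ m ∈ Finset.range M, c.hitSurv2 i k y m := by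
  rw [Finset.sum_range_succ', hitSurv2_zero c hix.ne' hxk.ne, add_comm]
  simp only [hitSurv2_succ, Finset.mul_sum]
  rw [Finset.sum_comm]

/-- A nonnegative solution of the Poisson equation with zero boundary values is the expected
exit time. -/
lemma hasSum_hitSurv2 (c : BDChain n) {i k : Fin (n + 1)} {h : Fin (n + 1) → ℝ}
    (hi : h i = 0) (hk : h k = 0) (h_nonneg : ∀ x, i < x → x < k → 0 ≤ h x)
    (h_eq : ∀ x, i < x → x < k → h x = 1 + ∑ y, c.K x y * h y)
    {x : Fin (n + 1)} (hix : i < x) (hxk : x < k) :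
    HasSum (c.hitSurv2 i k x) (h x) := by
  have upper : ∀ M : ℕ, ∀ x, i < x → x < k →
      ∑ m ∈ Finset.range M, c.hitSurv2 i k x m ≤ h x := by
    intro M
    induction M with
    | zero => simpa using h_nonneg
    | succ M ih =>
      intro x hix hxk
      rw [c.sum_range_succ_hitSurv2 hix hxk, h_eq x hix hxk, ← c.sum_killed2_mul_eq hix hxk hi hk]
      gcongr 1 + ?_
      exact c.sum_killed2_mul_le hix hxk ih
  obtain ⟨C, hC⟩ : ∃ C, ∀ x, h x ≤ C := by
    obtain ⟨C, hC⟩ := (Set.finite_range h).bddAbove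
    exact ⟨C, fun x => hC ⟨x, rfl⟩⟩
  have lower : ∀ M : ℕ, ∀ x, i < x → x < k →
      h x ≤ ∑ m ∈ Finset.range M, c.hitSurv2 i k x m + C * c.hitSurv2 i k x M := by
    intro M
    induction M with
    | zero =>
      intro x hix hxk
      simpa [hitSurv2_zero c hix.ne' hxk.ne] using hC x
    | succ M ih =>
      intro x hix hxk
      rw [c.sum_range_succ_hitSurv2 hix hxk, h_eq x hix hxk, ← c.sum_killed2_mul_eq hix hxk hi hk,
        hitSurv2_succ, add_assoc, Finset.mul_sum, ← Finset.sum_add_distrib]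
      gcongr 1 + ?_
      refine (c.sum_killed2_mul_le hix hxk ih).trans_eq (Finset.sum_congr rfl fun y _ => ?_)
      ring
  have summable : Summable (c.hitSurv2 i k x) :=
    summable_of_sum_range_le (c.hitSurv2_nonneg i k x) fun M => upper M x hix hxk
  refine (hasSum_iff_tendsto_nat_of_nonneg (c.hitSurv2_nonneg i k x) _).2 ?_
  have lim := tendsto_const_nhds (x := h x).sub (summable.tendsto_atTop_zero.const_mul C)
  rw [mul_zero, sub_zero] at lim
  exact tendsto_of_tendsto_of_tendsto_of_le_of_le lim tendsto_const_nhds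
    (fun M => sub_le_iff_le_add.2 (lower M x hix hxk)) fun M => upper M x hix hxk

lemma hitMean2C_eq_hitMean2 (c : BDChain n) {i k x : Fin (n + 1)}
    (hs : Summable (c.hitSurv2 i k x)) : c.hitMean2C i k x = c.hitMean2 i k x := by
  have weight (m : ℕ) :
      IntegrableOn (fun t : ℝ => Real.exp (-t) * t ^ m / m.factorial) (Set.Ioi 0) ∧
        ∫ t in Set.Ioi (0 : ℝ), Real.exp (-t) * t ^ m / m.factorial = 1 := by
    have hpos : (0 : ℝ) < m + 1 := by positivity
    have hgamma := Real.GammaIntegral_convergent hpos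
    have hval := Real.Gamma_eq_integral hpos
    simp only [add_sub_cancel_right, Real.rpow_natCast] at hgamma hval
    refine ⟨hgamma.div_const _, ?_⟩
    rw [integral_div, ← hval, Real.Gamma_nat_eq_factorial]
    exact div_self (by positivity)
  have hval (m : ℕ) : ∫ t in Set.Ioi (0 : ℝ),
      Real.exp (-t) * t ^ m / m.factorial * c.hitSurv2 i k x m = c.hitSurv2 i k x m := by
    rw [integral_mul_const, (weight m).2, one_mul]
  have hnorm (m : ℕ) : ∫ t in Set.Ioi (0 : ℝ),
      ‖Real.exp (-t) * t ^ m / m.factorial * c.hitSurv2 i k x m‖ = c.hitSurv2 i k x m := by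
    rw [← hval m]
    refine setIntegral_congr_fun measurableSet_Ioi fun t (ht : 0 < t) => ?_
    rw [hval m]
    exact Real.norm_of_nonneg (mul_nonneg (by positivity) (c.hitSurv2_nonneg i k x m))
  rw [hitMean2C, hitMean2, ← integral_tsum_of_summable_integral_norm
    (fun m => (weight m).1.mul_const _) (by simpa only [hnorm] using hs)]
  simp only [hval]

open scoped Fin.NatCast

lemma natCast_succ (m : ℕ) : ((m + 1 : ℕ) : Fin (n + 1)) = (m : Fin (n + 1)) + 1 := by
  ext
  simp [Fin.val_add]

lemma sum_fin_eq_sum_range (f : Fin (n + 1) → ℝ) :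
    ∑ x, f x = ∑ m ∈ Finset.range (n + 1), f m := by
  rw [← Fin.sum_univ_eq_sum_range (fun m => f m)]
  simp

lemma sum_fin_ite_Ico (a b : Fin (n + 1)) (f : Fin (n + 1) → ℝ) :
    (∑ x, if a ≤ x ∧ x < b then f x else 0) = ∑ m ∈ Finset.Ico (a : ℕ) b, f m := by
  rw [sum_fin_eq_sum_range, ← Finset.sum_filter]
  refine Finset.sum_congr (Finset.ext fun m => ?_) fun _ _ => rfl
  simp only [Finset.mem_filter, Finset.mem_range, Finset.mem_Ico]
  constructor
  · rintro ⟨hm, h⟩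
    simpa only [Fin.le_def, Fin.lt_def, Fin.val_cast_of_lt hm] using h
  · intro h
    have hm : m < n + 1 := h.2.trans b.isLt
    simpa only [Fin.le_def, Fin.lt_def, Fin.val_cast_of_lt hm, hm, true_and] using h

lemma sum_fin_ite_Ioc (a b : Fin (n + 1)) (f : Fin (n + 1) → ℝ) :
    (∑ x, if a < x ∧ x ≤ b then f x else 0) =
      ∑ m ∈ Finset.Ico (a : ℕ) b, f ((m + 1 : ℕ) : Fin (n + 1)) := by
  rw [sum_fin_eq_sum_range, ← Finset.sum_filter,
    Finset.sum_Ico_add' (fun m : ℕ => f (m : Fin (n + 1))) (a : ℕ) b 1]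
  refine Finset.sum_congr (Finset.ext fun m => ?_) fun _ _ => rfl
  simp only [Finset.mem_filter, Finset.mem_range, Finset.mem_Ico]
  constructor
  · rintro ⟨hm, h⟩
    simp only [Fin.le_def, Fin.lt_def, Fin.val_cast_of_lt hm] at h
    omega
  · intro h
    have hm : m < n + 1 := by omega
    simp only [Fin.le_def, Fin.lt_def, Fin.val_cast_of_lt hm]
    omega

lemma K_natCast_eq_zero (c : BDChain n) {x y : ℕ} (hx : x < n + 1) (hy : y < n + 1)
    (h : x + 1 < y ∨ y + 1 < x) : c.K x y = 0 := by
  apply c.K_tridiag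
  rw [Fin.val_cast_of_lt hx, Fin.val_cast_of_lt hy, lt_abs]
  omega

lemma K_natCast_succ_pos (c : BDChain n) {m : ℕ} (hm : m < n) :
    0 < c.K m ((m + 1 : ℕ) : Fin (n + 1)) := by
  convert (c.K_irred m hm).1 using 2 <;> ext <;> simp only [Fin.val_natCast] <;>
    exact Nat.mod_eq_of_lt (by omega)

lemma detailed_balance (c : BDChain n) {m : ℕ} (hm : m < n) :
    c.pi m * c.K m ((m + 1 : ℕ) : Fin (n + 1)) =
      c.pi ((m + 1 : ℕ) : Fin (n + 1)) * c.K ((m + 1 : ℕ) : Fin (n + 1)) m := by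
  have net (x : Fin (n + 1)) :
      ∑ y ∈ Finset.range (n + 1), (c.pi x * c.K x y - c.pi y * c.K y x) = 0 := by
    rw [← sum_fin_eq_sum_range fun y => c.pi x * c.K x y - c.pi y * c.K y x,
      Finset.sum_sub_distrib, ← Finset.mul_sum, c.K_rowSum, c.pi_stat, mul_one, sub_self]
  induction m with
  | zero =>
    have h := net ((0 : ℕ) : Fin (n + 1))
    rw [← Finset.sum_subset (s₁ := {0, 1})] at h
    · rw [Finset.sum_pair (by omega)] at h
      simp only [zero_add]
      linarith
    · intro y hy
      simp only [Finset.mem_insert, Finset.mem_singleton, Finset.mem_range] at hy ⊢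
      omega
    · intro y hy hy'
      simp only [Finset.mem_insert, Finset.mem_singleton, Finset.mem_range] at hy hy'
      rw [c.K_natCast_eq_zero (by omega) hy (by omega),
        c.K_natCast_eq_zero hy (by omega) (by omega), mul_zero, mul_zero, sub_zero]
  | succ m ih =>
    have h := net ((m + 1 : ℕ) : Fin (n + 1))
    rw [← Finset.sum_subset (s₁ := {m, m + 1, m + 2})] at h
    · rw [Finset.sum_insert (by simp), Finset.sum_pair (by omega)] at h
      have := ih (by omega)
      linarith
    · intro y hy
      simp only [Finset.mem_insert, Finset.mem_singleton, Finset.mem_range] at hy ⊢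
      omega
    · intro y hy hy'
      simp only [Finset.mem_insert, Finset.mem_singleton, Finset.mem_range] at hy hy'
      rw [c.K_natCast_eq_zero (by omega) hy (by omega),
        c.K_natCast_eq_zero hy (by omega) (by omega), mul_zero, mul_zero, sub_zero]

lemma sum_K_mul_natCast (c : BDChain n) {m : ℕ} (hm : m + 1 < n) (h : ℕ → ℝ) :
    ∑ y : Fin (n + 1), c.K ((m + 1 : ℕ) : Fin (n + 1)) y * h y =
      h (m + 1) + c.K ((m + 1 : ℕ) : Fin (n + 1)) m * (h m - h (m + 1)) +
        c.K ((m + 1 : ℕ) : Fin (n + 1)) ((m + 2 : ℕ) : Fin (n + 1)) * (h (m + 2) - h (m + 1)) := by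
  have three (g : Fin (n + 1) → ℝ) :
      ∑ y : Fin (n + 1), c.K ((m + 1 : ℕ) : Fin (n + 1)) y * g y =
        c.K ((m + 1 : ℕ) : Fin (n + 1)) m * g m +
        (c.K ((m + 1 : ℕ) : Fin (n + 1)) ((m + 1 : ℕ) : Fin (n + 1)) *
            g ((m + 1 : ℕ) : Fin (n + 1)) +
          c.K ((m + 1 : ℕ) : Fin (n + 1)) ((m + 2 : ℕ) : Fin (n + 1)) *
            g ((m + 2 : ℕ) : Fin (n + 1))) := by
    rw [sum_fin_eq_sum_range, ← Finset.sum_subset (s₁ := {m, m + 1, m + 2}),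
      Finset.sum_insert (by simp), Finset.sum_pair (by omega)]
    · intro y hy
      simp only [Finset.mem_insert, Finset.mem_singleton, Finset.mem_range] at hy ⊢
      omega
    · intro y hy hy'
      simp only [Finset.mem_insert, Finset.mem_singleton, Finset.mem_range] at hy hy'
      rw [c.K_natCast_eq_zero (by omega) hy (by omega), zero_mul]
  have row := three fun _ => 1
  simp only [mul_one, c.K_rowSum] at row
  rw [three fun y => h y, Fin.val_cast_of_lt (by omega), Fin.val_cast_of_lt (by omega),
    Fin.val_cast_of_lt (by omega)]
  linear_combination -h (m + 1) * row

/-- The resistance of the edge between the states `m` and `m + 1`. -/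
def resistance (c : BDChain n) (m : ℕ) : ℝ :=
  (c.pi m * c.K m ((m + 1 : ℕ) : Fin (n + 1)))⁻¹

/-- The stationary mass `π([0, m])`, as a function of a natural number. -/
def cumMass (c : BDChain n) (m : ℕ) : ℝ := ∑ t ∈ Finset.range (m + 1), c.pi t

lemma resistance_pos (c : BDChain n) {m : ℕ} (hm : m < n) : 0 < c.resistance m :=
  inv_pos.2 (mul_pos (c.pi_pos _) (c.K_natCast_succ_pos hm))

lemma cumMass_mono (c : BDChain n) : Monotone c.cumMass :=
  monotone_nat_of_le_succ fun m => by
    rw [cumMass, cumMass, Finset.sum_range_succ _ (m + 1)]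
    exact le_add_of_nonneg_right (c.pi_pos _).le

lemma piInt_natCast (c : BDChain n) {a b : ℕ} (hab : a < b) (hb : b < n + 1) :
    c.piInt ((a + 1 : ℕ) : Fin (n + 1)) b = c.cumMass b - c.cumMass a := by
  rw [piInt, cumMass, cumMass, ← Finset.sum_Ico_eq_sub _ (by omega), sum_fin_eq_sum_range,
    ← Finset.sum_filter]
  refine Finset.sum_congr (Finset.ext fun m => ?_) fun _ _ => rfl
  simp only [Finset.mem_filter, Finset.mem_range, Finset.mem_Ico]
  constructor
  · rintro ⟨hm, h⟩
    simp only [Fin.le_def, Fin.val_cast_of_lt hm, Fin.val_cast_of_lt hb,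
      Fin.val_cast_of_lt (show a + 1 < n + 1 by omega)] at h
    omega
  · intro h
    have hm : m < n + 1 := by omega
    simp only [Fin.le_def, Fin.val_cast_of_lt hm, Fin.val_cast_of_lt hb,
      Fin.val_cast_of_lt (show a + 1 < n + 1 by omega)]
    omega

end BDChain

lemma sum_Ico_mul_mul_sub (R G : ℕ → ℝ) {i j k : ℕ} (hij : i ≤ j) (hjk : j ≤ k) :
    ∑ a ∈ Finset.Ico i j, ∑ b ∈ Finset.Ico j k, R a * R b * (G b - G a) =
      (∑ a ∈ Finset.Ico i j, R a) * (∑ a ∈ Finset.Ico i k, R a * G a) -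
        (∑ a ∈ Finset.Ico i k, R a) * ∑ a ∈ Finset.Ico i j, R a * G a := by
  rw [← Finset.sum_Ico_consecutive R hij hjk,
    ← Finset.sum_Ico_consecutive (fun a => R a * G a) hij hjk]
  have h : ∑ a ∈ Finset.Ico i j, ∑ b ∈ Finset.Ico j k, R a * R b * (G b - G a) =
      (∑ a ∈ Finset.Ico i j, R a) * (∑ b ∈ Finset.Ico j k, R b * G b) -
        (∑ a ∈ Finset.Ico i j, R a * G a) * ∑ b ∈ Finset.Ico j k, R b := by
    simp only [Finset.sum_mul_sum, ← Finset.sum_sub_distrib]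
    exact Finset.sum_congr rfl fun a _ => Finset.sum_congr rfl fun b _ => by ring
  rw [h]
  ring

namespace BDChain

variable {n : ℕ}

open scoped Fin.NatCast

/-- The solution of the Poisson equation on the states strictly between `i` and `k`. -/
def exitPotential (c : BDChain n) (i k x : ℕ) : ℝ :=
  (∑ a ∈ Finset.Ico i x, ∑ b ∈ Finset.Ico x k,
      c.resistance a * c.resistance b * (c.cumMass b - c.cumMass a)) /
    ∑ a ∈ Finset.Ico i k, c.resistance a

lemma exitPotential_nonneg (c : BDChain n) {i k : ℕ} (hk : k ≤ n) (x : ℕ) :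
    0 ≤ c.exitPotential i k x := by
  have res {a : ℕ} (ha : a < k) : 0 ≤ c.resistance a := (c.resistance_pos (by omega)).le
  refine div_nonneg (Finset.sum_nonneg fun a ha => Finset.sum_nonneg fun b hb => ?_)
    (Finset.sum_nonneg fun a ha => res (Finset.mem_Ico.1 ha).2)
  rw [Finset.mem_Ico] at ha hb
  exact mul_nonneg (mul_nonneg (res (by omega)) (res hb.2))
    (sub_nonneg.2 (c.cumMass_mono (by omega)))

lemma exitPotential_eq (c : BDChain n) {i k x : ℕ} (hix : i ≤ x) (hxk : x ≤ k) (hik : i < k)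
    (hk : k ≤ n) :
    c.exitPotential i k x =
      (∑ a ∈ Finset.Ico i x, c.resistance a) *
          ((∑ a ∈ Finset.Ico i k, c.resistance a * c.cumMass a) /
            ∑ a ∈ Finset.Ico i k, c.resistance a) -
        ∑ a ∈ Finset.Ico i x, c.resistance a * c.cumMass a := by
  have hB : 0 < ∑ a ∈ Finset.Ico i k, c.resistance a :=
    Finset.sum_pos (fun a ha => c.resistance_pos (by rw [Finset.mem_Ico] at ha; omega))
      (Finset.nonempty_Ico.2 hik)
  rw [exitPotential, sum_Ico_mul_mul_sub _ _ hix hxk]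
  field_simp

lemma exitPotential_poisson (c : BDChain n) {i k m : ℕ} (him : i < m + 1) (hmk : m + 1 < k)
    (hk : k ≤ n) :
    c.exitPotential i k (m + 1) =
      1 + ∑ y : Fin (n + 1), c.K ((m + 1 : ℕ) : Fin (n + 1)) y * c.exitPotential i k y := by
  rw [c.sum_K_mul_natCast (by omega), c.exitPotential_eq him.le hmk.le (by omega) hk,
    c.exitPotential_eq (by omega : i ≤ m) (by omega) (by omega) hk,
    c.exitPotential_eq (by omega : i ≤ m + 2) (by omega) (by omega) hk,
    Finset.sum_Ico_succ_top (by omega : i ≤ m + 1), Finset.sum_Ico_succ_top (by omega : i ≤ m + 1),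
    Finset.sum_Ico_succ_top (by omega : i ≤ m), Finset.sum_Ico_succ_top (by omega : i ≤ m)]
  generalize (∑ a ∈ Finset.Ico i k, c.resistance a * c.cumMass a) /
    ∑ a ∈ Finset.Ico i k, c.resistance a = D
  have hG : c.cumMass (m + 1) = c.cumMass m + c.pi ((m + 1 : ℕ) : Fin (n + 1)) :=
    Finset.sum_range_succ _ _
  have hpi := (c.pi_pos ((m + 1 : ℕ) : Fin (n + 1))).ne'
  have left : c.K ((m + 1 : ℕ) : Fin (n + 1)) m * c.resistance m =
      (c.pi ((m + 1 : ℕ) : Fin (n + 1)))⁻¹ := by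
    have h := (mul_pos (c.pi_pos m) (c.K_natCast_succ_pos (by omega : m < n))).ne'
    rw [resistance, c.detailed_balance (by omega)]
    rw [c.detailed_balance (by omega)] at h
    have := right_ne_zero_of_mul h
    field_simp
  have right : c.K ((m + 1 : ℕ) : Fin (n + 1)) ((m + 2 : ℕ) : Fin (n + 1)) *
      c.resistance (m + 1) = (c.pi ((m + 1 : ℕ) : Fin (n + 1)))⁻¹ := by
    have h := (c.K_natCast_succ_pos (by omega : m + 1 < n)).ne'
    rw [resistance]
    field_simp
  have cancel := mul_inv_cancel₀ hpi
  linear_combination (D - c.cumMass m) * left - (D - c.cumMass (m + 1)) * right +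
    (c.pi ((m + 1 : ℕ) : Fin (n + 1)))⁻¹ * hG + cancel

lemma hasSum_hitSurv2_exitPotential (c : BDChain n) {i j k : Fin (n + 1)} (hij : i < j)
    (hjk : j < k) : HasSum (c.hitSurv2 i k j) (c.exitPotential i k j) := by
  have hk : (k : ℕ) ≤ n := by omega
  refine c.hasSum_hitSurv2 (h := fun x => c.exitPotential i k x) ?_ ?_
    (fun x _ _ => c.exitPotential_nonneg hk x) (fun x hix hxk => ?_) hij hjk
  · simp [exitPotential]
  · simp [exitPotential]
  · rw [Fin.lt_def] at hix hxk
    obtain ⟨m, hm⟩ := Nat.exists_eq_add_of_lt (Nat.zero_lt_of_lt hix)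
    rw [zero_add] at hm
    have hx : x = ((m + 1 : ℕ) : Fin (n + 1)) := by rw [← hm, Fin.cast_val_eq_self]
    have := c.exitPotential_poisson (by omega : (i : ℕ) < m + 1) (by omega) hk
    rwa [← hx, ← hm] at this

end BDChain

/-- Lemma `l-hit3`.  For `i < j < k`,
`E_j min{τ_i, τ_k} = E_j min{τ̃_i, τ̃_k} = A/B` with
`A = Σ_{i+1 ≤ ℓ₁ ≤ j, j ≤ ℓ₂ ≤ k−1} π([ℓ₁,ℓ₂])/(π(ℓ₁)q_{ℓ₁} π(ℓ₂)p_{ℓ₂})` and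
`B = Σ_{ℓ=i}^{k−1} 1/(π(ℓ)p_ℓ)`. -/
theorem birth_death_exit_time_formula
    {n : ℕ} (c : BDChain n) (i j k : Fin (n + 1)) (hij : i < j) (hjk : j < k) :
    c.hitMean2 i k j = c.hitMean2C i k j ∧
    c.hitMean2 i k j =
      (∑ ℓ₁ : Fin (n + 1), ∑ ℓ₂ : Fin (n + 1),
        if i < ℓ₁ ∧ ℓ₁ ≤ j ∧ j ≤ ℓ₂ ∧ ℓ₂ < k then
          c.piInt ℓ₁ ℓ₂ / (c.pi ℓ₁ * c.K ℓ₁ (ℓ₁ - 1) * (c.pi ℓ₂ * c.K ℓ₂ (ℓ₂ + 1)))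
        else 0) /
      (∑ ℓ : Fin (n + 1), if i ≤ ℓ ∧ ℓ < k then (c.pi ℓ * c.K ℓ (ℓ + 1))⁻¹ else 0) := by
  have hsum := c.hasSum_hitSurv2_exitPotential hij hjk
  refine ⟨(c.hitMean2C_eq_hitMean2 hsum.summable).symm, ?_⟩
  rw [BDChain.hitMean2, hsum.tsum_eq, BDChain.exitPotential]
  congr 1
  · have ite_split (a b : Fin (n + 1)) (u : ℝ) :
        (if i < a ∧ a ≤ j ∧ j ≤ b ∧ b < k then u else 0) =
          if i < a ∧ a ≤ j then if j ≤ b ∧ b < k then u else 0 else 0 := by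
      simp only [← ite_and, and_assoc]
    simp only [ite_split, Finset.sum_ite_irrel, Finset.sum_const_zero, BDChain.sum_fin_ite_Ico,
      BDChain.sum_fin_ite_Ioc]
    refine Finset.sum_congr rfl fun a ha => Finset.sum_congr rfl fun b hb => ?_
    rw [Finset.mem_Ico] at ha hb
    rw [c.piInt_natCast (by omega) (by omega), BDChain.resistance, c.detailed_balance (by omega),
      BDChain.resistance, BDChain.natCast_succ, BDChain.natCast_succ, add_sub_cancel_right, ← mul_inv,
      div_eq_inv_mul]
  · rw [BDChain.sum_fin_ite_Ico]
    exact Finset.sum_congr rfl fun a _ => by rw [BDChain.resistance, BDChain.natCast_succ]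

end
end
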